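/- arXiv:1509.03863 — 7 statements merged into one kernel-verified Lean document; each statement's English description precedes it below -/
import Mathlib

section
/- Let γ>0. For each n∈ℕ let Λ_n=(λ_{n,ν})_{ν≥1} and let Λ=(λ_ν)_{ν≥1} be nondecreasing sequences of positive real numbers such that ∑_{ν≥1} λ_ν^{−γ} < ∞, such that ∑_{ν≥1} λ_{n,ν}^{−γ} < ∞ for every n, and such that the family (Λ_n) has uniformly summable tails at γ. Then the following are equivalent: (i) for every s∈ℂ with Re(s)>γ, D_{Λ_n}(s) → D_Λ(s) as n→∞; (ii) ∑_{ν≥1} |λ_{n,ν}^{−γ} − λ_ν^{−γ}| → 0 as n→∞, i.e. the sequences (λ_{n,ν}^{−γ})_ν converge to (λ_ν^{−γ})_ν in ℓ¹. -/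
open Filter Topology

/-- A family of sequences `Λ_n` has uniformly summable tails at `γ` if for every `ε > 0`
there is an `N` such that `∑_{ν ≥ N} Λ n ν ^ (-γ) < ε` for all `n`. -/
def UniformlySummableTails (γ : ℝ) (Λ : ℕ → ℕ → ℝ) : Prop :=
  ∀ ε > 0, ∃ N : ℕ, ∀ n, ∑' ν : ℕ, Λ n (N + ν) ^ (-γ) < ε

lemma summable_pow_add_two {b : ℕ → ℝ} (hb : ∀ ν, 0 ≤ b ν) (hanti : Antitone b)
    (h2 : Summable fun ν => b ν ^ 2) (m : ℕ) : Summable fun ν => b ν ^ (m + 2) := by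
  refine Summable.of_nonneg_of_le (fun ν => pow_nonneg (hb ν) _) (fun ν => ?_)
    (h2.mul_left (b 0 ^ m))
  rw [pow_add]
  exact mul_le_mul_of_nonneg_right (pow_le_pow_left₀ (hb ν) (hanti ν.zero_le) m)
    (pow_nonneg (hb ν) 2)

lemma tsum_pow_add_two_le {b : ℕ → ℝ} (hb : ∀ ν, 0 ≤ b ν) (hanti : Antitone b)
    (h2 : Summable fun ν => b ν ^ 2) (m : ℕ) :
    ∑' ν, b ν ^ (m + 2) ≤ b 0 ^ m * ∑' ν, b ν ^ 2 := by
  rw [← tsum_mul_left]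
  refine (summable_pow_add_two hb hanti h2 m).tsum_le_tsum (fun ν => ?_) (h2.mul_left _)
  rw [pow_add]
  exact mul_le_mul_of_nonneg_right (pow_le_pow_left₀ (hb ν) (hanti ν.zero_le) m)
    (pow_nonneg (hb ν) 2)

lemma zero_pow_le_tsum_pow_add_two {b : ℕ → ℝ} (hb : ∀ ν, 0 ≤ b ν) (hanti : Antitone b)
    (h2 : Summable fun ν => b ν ^ 2) (m : ℕ) : b 0 ^ (m + 2) ≤ ∑' ν, b ν ^ (m + 2) :=
  (summable_pow_add_two hb hanti h2 m).le_tsum 0 fun ν _ => pow_nonneg (hb ν) _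

lemma exists_pow_mul_lt_pow_mul {x y A B : ℝ} (hx : 0 ≤ x) (hxy : x < y) (hB : 0 < B) :
    ∃ m : ℕ, x ^ m * A < y ^ m * B := by
  have hy : 0 < y := hx.trans_lt hxy
  have h : Tendsto (fun m : ℕ => (x / y) ^ m * A) atTop (𝓝 0) := by
    simpa using (tendsto_pow_atTop_nhds_zero_of_lt_one (div_nonneg hx hy.le)
      ((div_lt_one hy).2 hxy)).mul_const A
  obtain ⟨m, hm⟩ := (h.eventually_lt_const hB).exists
  refine ⟨m, ?_⟩
  have := mul_lt_mul_of_pos_left hm (pow_pos hy m)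
  rwa [div_pow, ← mul_assoc, mul_div_cancel₀ _ (pow_pos hy m).ne'] at this

/-- If the power sums of antitone nonnegative sequences converge to those of an antitone positive
sequence, then the largest terms converge. -/
lemma tendsto_apply_zero_of_tendsto_tsum_pow {a : ℕ → ℕ → ℝ} {b : ℕ → ℝ}
    (ha : ∀ n ν, 0 ≤ a n ν) (hb : ∀ ν, 0 < b ν)
    (ha_anti : ∀ n, Antitone (a n)) (hb_anti : Antitone b)
    (ha2 : ∀ n, Summable fun ν => a n ν ^ 2) (hb2 : Summable fun ν => b ν ^ 2)
    (h : ∀ m : ℕ, Tendsto (fun n => ∑' ν, a n ν ^ (m + 2)) atTop (𝓝 (∑' ν, b ν ^ (m + 2)))) :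
    Tendsto (fun n => a n 0) atTop (𝓝 (b 0)) := by
  have hb' : ∀ ν, 0 ≤ b ν := fun ν => (hb ν).le
  refine tendsto_order.2 ⟨fun l hl => ?_, fun u hu => ?_⟩
  · rcases lt_or_ge l 0 with hl0 | hl0
    · exact Eventually.of_forall fun n => hl0.trans_le (ha n 0)
    obtain ⟨m, hm⟩ := exists_pow_mul_lt_pow_mul (A := ∑' ν, b ν ^ 2 + 1) hl0 hl (pow_pos (hb 0) 2)
    rw [← pow_add] at hm
    have hm' := hm.trans_le (zero_pow_le_tsum_pow_add_two hb' hb_anti hb2 m)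
    filter_upwards [(h m).eventually_const_lt hm',
      (h 0).eventually_lt_const (lt_add_one _)] with n hn hn2
    by_contra! hle
    simp only [zero_add] at hn2
    refine lt_irrefl _ (hn.trans_le ((tsum_pow_add_two_le (ha n) (ha_anti n) (ha2 n) m).trans ?_))
    exact mul_le_mul (pow_le_pow_left₀ (ha n 0) hle m) hn2.le
      (tsum_nonneg fun ν => sq_nonneg _) (pow_nonneg hl0 m)
  · have hu0 : 0 < u := (hb 0).trans hu
    obtain ⟨m, hm⟩ := exists_pow_mul_lt_pow_mul (A := ∑' ν, b ν ^ 2) (hb' 0) hu (pow_pos hu0 2)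
    rw [← pow_add] at hm
    have hm' := (tsum_pow_add_two_le hb' hb_anti hb2 m).trans_lt hm
    filter_upwards [(h m).eventually_lt_const hm'] with n hn
    exact lt_of_pow_lt_pow_left₀ (m + 2) hu0.le
      ((zero_pow_le_tsum_pow_add_two (ha n) (ha_anti n) (ha2 n) m).trans_lt hn)

/-- If the power sums of antitone nonnegative sequences converge to those of an antitone positive
sequence, then the sequences converge termwise. -/
lemma tendsto_apply_of_tendsto_tsum_pow (ν : ℕ) {a : ℕ → ℕ → ℝ} {b : ℕ → ℝ}
    (ha : ∀ n ν, 0 ≤ a n ν) (hb : ∀ ν, 0 < b ν)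
    (ha_anti : ∀ n, Antitone (a n)) (hb_anti : Antitone b)
    (ha2 : ∀ n, Summable fun ν => a n ν ^ 2) (hb2 : Summable fun ν => b ν ^ 2)
    (h : ∀ m : ℕ, Tendsto (fun n => ∑' ν, a n ν ^ (m + 2)) atTop (𝓝 (∑' ν, b ν ^ (m + 2)))) :
    Tendsto (fun n => a n ν) atTop (𝓝 (b ν)) := by
  have h0 := tendsto_apply_zero_of_tendsto_tsum_pow ha hb ha_anti hb_anti ha2 hb2 h
  induction ν generalizing a b with
  | zero => exact h0
  | succ ν ih =>
    have ha_anti' : ∀ n, Antitone fun μ => a n (μ + 1) :=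
      fun n i j hij => ha_anti n (Nat.succ_le_succ hij)
    have hb_anti' : Antitone fun μ => b (μ + 1) := fun i j hij => hb_anti (Nat.succ_le_succ hij)
    have ha2' : ∀ n, Summable fun μ => a n (μ + 1) ^ 2 :=
      fun n => (summable_nat_add_iff 1).2 (ha2 n)
    have hb2' : Summable fun μ => b (μ + 1) ^ 2 :=
      (summable_nat_add_iff (f := fun μ => b μ ^ 2) 1).2 hb2
    have h' : ∀ m : ℕ, Tendsto (fun n => ∑' μ, a n (μ + 1) ^ (m + 2)) atTop
        (𝓝 (∑' μ, b (μ + 1) ^ (m + 2))) := by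
      intro m
      have key := (h m).sub (h0.pow (m + 2))
      rw [(summable_pow_add_two (fun ν => (hb ν).le) hb_anti hb2 m).tsum_eq_zero_add] at key
      simp_rw [fun n => (summable_pow_add_two (ha n) (ha_anti n) (ha2 n) m).tsum_eq_zero_add,
        add_sub_cancel_left] at key
      exact key
    exact ih (a := fun n μ => a n (μ + 1)) (b := fun μ => b (μ + 1)) (fun n μ => ha n _)
      (fun μ => hb _) ha_anti' hb_anti' ha2' hb2' h'
      (tendsto_apply_zero_of_tendsto_tsum_pow (fun n μ => ha n (μ + 1)) (fun μ => hb (μ + 1))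
        ha_anti' hb_anti' ha2' hb2' h')

/-- Termwise convergence together with uniformly small tails gives convergence in `ℓ¹`. -/
lemma tendsto_tsum_abs_sub_of_tails {a : ℕ → ℕ → ℝ} {b : ℕ → ℝ}
    (ha : ∀ n ν, 0 ≤ a n ν) (hb : ∀ ν, 0 ≤ b ν)
    (ha_sum : ∀ n, Summable (a n)) (hb_sum : Summable b)
    (htails : ∀ ε > 0, ∃ N : ℕ, ∀ n, ∑' ν, a n (N + ν) < ε)
    (h : ∀ ν, Tendsto (fun n => a n ν) atTop (𝓝 (b ν))) :
    Tendsto (fun n => ∑' ν, |a n ν - b ν|) atTop (𝓝 0) := by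
  have hdiff : ∀ ν, Tendsto (fun n => |a n ν - b ν|) atTop (𝓝 0) := fun ν => by
    simpa using ((h ν).sub_const (b ν)).abs
  have hbound : ∀ n ν, ‖max (b ν - a n ν) 0‖ ≤ b ν := fun n ν => by
    rw [Real.norm_of_nonneg (le_max_right _ _)]
    exact max_le (sub_le_self _ (ha n ν)) (hb ν)
  have hpos : Tendsto (fun n => ∑' ν, max (b ν - a n ν) 0) atTop (𝓝 0) := by
    have := tendsto_tsum_of_dominated_convergence (𝓕 := atTop)
      (f := fun n ν => max (b ν - a n ν) 0) (g := fun _ => (0 : ℝ)) hb_sum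
      (fun ν => by simpa using ((h ν).const_sub (b ν)).max (tendsto_const_nhds (x := (0 : ℝ))))
      (Eventually.of_forall hbound)
    simpa using this
  refine tendsto_order.2 ⟨fun l hl => Eventually.of_forall fun n =>
    hl.trans_le (tsum_nonneg fun ν => abs_nonneg _), fun ε hε => ?_⟩
  obtain ⟨N, hN⟩ := htails (ε / 2) (half_pos hε)
  have hsmall : Tendsto (fun n => ∑ ν ∈ Finset.range N, |a n ν - b ν| +
      2 * ∑' ν, max (b ν - a n ν) 0) atTop (𝓝 0) := by
    simpa using (tendsto_finsetSum (Finset.range N) fun ν _ => hdiff ν).add (hpos.const_mul 2)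
  filter_upwards [hsmall.eventually_lt_const (half_pos hε)] with n hn
  have hs : Summable fun ν => |a n ν - b ν| := ((ha_sum n).sub hb_sum).abs
  have hp : Summable fun ν => max (b ν - a n ν) 0 := .of_norm_bounded hb_sum (hbound n)
  have hshift : ∀ {f : ℕ → ℝ}, Summable f → Summable fun ν => f (N + ν) := fun hf =>
    hf.comp_injective (add_right_injective N)
  have htail : ∑' ν, |a n (N + ν) - b (N + ν)| ≤
      ∑' ν, a n (N + ν) + 2 * ∑' ν, max (b (N + ν) - a n (N + ν)) 0 := by
    rw [← tsum_mul_left, ← (hshift (ha_sum n)).tsum_add ((hshift hp).mul_left 2)]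
    refine (hshift hs).tsum_le_tsum (fun ν => ?_) ((hshift (ha_sum n)).add ((hshift hp).mul_left 2))
    have := hb (N + ν)
    have := ha n (N + ν)
    rw [abs_le]
    constructor <;>
      linarith [le_max_left (b (N + ν) - a n (N + ν)) 0, le_max_right (b (N + ν) - a n (N + ν)) 0]
  have hp_tail : ∑' ν, max (b (N + ν) - a n (N + ν)) 0 ≤ ∑' ν, max (b ν - a n ν) 0 :=
    tsum_comp_le_tsum_of_inj hp (fun ν => le_max_right _ _) (add_right_injective N)
  have hsplit := hs.sum_add_tsum_nat_add N
  simp_rw [add_comm _ N] at hsplit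
  linarith [hN n]

/-- On `(0, C]` the function `t ↦ t ^ z` is Lipschitz when `1 ≤ re z`. -/
lemma norm_ofReal_cpow_sub_le {z : ℂ} (hz : 1 ≤ z.re) {C x y : ℝ} (hx : x ∈ Set.Ioc 0 C)
    (hy : y ∈ Set.Ioc 0 C) :
    ‖(y : ℂ) ^ z - (x : ℂ) ^ z‖ ≤ ‖z‖ * C ^ (z.re - 1) * |y - x| := by
  have hz0 : z ≠ 0 := by
    rintro rfl
    norm_num at hz
  refine (convex_Ioc 0 C).norm_image_sub_le_of_norm_hasDerivWithin_le
    (f := fun t : ℝ => (t : ℂ) ^ z) (f' := fun t : ℝ => z * (t : ℂ) ^ (z - 1))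
    (fun t ht => (hasDerivAt_ofReal_cpow_const ht.1.ne' hz0).hasDerivWithinAt)
    (fun t ht => ?_) hx hy
  rw [norm_mul, Complex.norm_cpow_eq_rpow_re_of_pos ht.1, Complex.sub_re, Complex.one_re]
  exact mul_le_mul_of_nonneg_left (Real.rpow_le_rpow ht.1.le ht.2 (sub_nonneg.2 hz)) (norm_nonneg z)

lemma summable_ofReal_cpow {z : ℂ} (hz : 1 ≤ z.re) {b : ℕ → ℝ} (hb : ∀ ν, 0 < b ν)
    (hanti : Antitone b) (hsum : Summable b) : Summable fun ν => (b ν : ℂ) ^ z := by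
  refine .of_norm_bounded (hsum.mul_left (b 0 ^ (z.re - 1))) fun ν => ?_
  rw [Complex.norm_cpow_eq_rpow_re_of_pos (hb ν)]
  calc b ν ^ z.re = b ν ^ (z.re - 1) * b ν := by
        rw [← Real.rpow_add_one (hb ν).ne', sub_add_cancel]
    _ ≤ b 0 ^ (z.re - 1) * b ν := mul_le_mul_of_nonneg_right
        (Real.rpow_le_rpow (hb ν).le (hanti ν.zero_le) (sub_nonneg.2 hz)) (hb ν).le

lemma tendsto_tsum_cpow_of_tendsto_l1 {z : ℂ} (hz : 1 ≤ z.re) {a : ℕ → ℕ → ℝ} {b : ℕ → ℝ}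
    (ha : ∀ n ν, 0 < a n ν) (hb : ∀ ν, 0 < b ν)
    (ha_anti : ∀ n, Antitone (a n)) (hb_anti : Antitone b)
    (ha_sum : ∀ n, Summable (a n)) (hb_sum : Summable b)
    (h : Tendsto (fun n => ∑' ν, |a n ν - b ν|) atTop (𝓝 0)) :
    Tendsto (fun n => ∑' ν, (a n ν : ℂ) ^ z) atTop (𝓝 (∑' ν, (b ν : ℂ) ^ z)) := by
  rw [tendsto_iff_norm_sub_tendsto_zero]
  set C := b 0 + 1
  have hlim : Tendsto (fun n => ‖z‖ * C ^ (z.re - 1) * ∑' ν, |a n ν - b ν|) atTop (𝓝 0) := by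
    simpa using h.const_mul (‖z‖ * C ^ (z.re - 1))
  refine squeeze_zero' (Eventually.of_forall fun n => norm_nonneg _) ?_ hlim
  filter_upwards [h.eventually_lt_const one_pos] with n hn
  have hs : Summable fun ν => |a n ν - b ν| := ((ha_sum n).sub hb_sum).abs
  have h0 : a n 0 ≤ C := by
    have := (le_abs_self _).trans (hs.le_tsum 0 fun ν _ => abs_nonneg _)
    linarith
  rw [← (summable_ofReal_cpow hz (ha n) (ha_anti n) (ha_sum n)).tsum_sub
    (summable_ofReal_cpow hz hb hb_anti hb_sum), ← tsum_mul_left]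
  refine tsum_of_norm_bounded (hs.mul_left _).hasSum fun ν => ?_
  exact norm_ofReal_cpow_sub_le hz
    ⟨hb ν, (hb_anti ν.zero_le).trans (le_add_of_nonneg_right zero_le_one)⟩
    ⟨ha n ν, (ha_anti n ν.zero_le).trans h0⟩

lemma ofReal_cpow_neg_eq {γ t : ℝ} (hγ : γ ≠ 0) (ht : 0 < t) (s : ℂ) :
    (t : ℂ) ^ (-s) = ((t ^ (-γ) : ℝ) : ℂ) ^ (s / γ) := by
  have hγ' : (γ : ℂ) ≠ 0 := Complex.ofReal_ne_zero.2 hγ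
  rw [Complex.cpow_def_of_ne_zero (Complex.ofReal_ne_zero.2 ht.ne'),
    Complex.cpow_def_of_ne_zero (Complex.ofReal_ne_zero.2 (Real.rpow_pos_of_pos ht _).ne'),
    ← Complex.ofReal_log ht.le, ← Complex.ofReal_log (Real.rpow_pos_of_pos ht _).le,
    Real.log_rpow ht]
  push_cast
  congr 1
  field_simp

/-- under uniform summability of tails, pointwise convergence of the Dirichlet
series `D_{Λ_n}(s) → D_Λ(s)` on `Re s > γ` is equivalent to ℓ¹ convergence of
`(λ_{n,ν}^{-γ})_ν` to `(λ_ν^{-γ})_ν`. -/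
theorem dirichlet_series_tendsto_iff_l1
    (γ : ℝ) (hγ : 0 < γ)
    (Λ : ℕ → ℕ → ℝ) (lam : ℕ → ℝ)
    (hΛpos : ∀ n ν, 0 < Λ n ν) (hΛmono : ∀ n, Monotone (Λ n))
    (hlampos : ∀ ν, 0 < lam ν) (hlammono : Monotone lam)
    (hsum : ∀ n, Summable (fun ν => Λ n ν ^ (-γ)))
    (hsuml : Summable (fun ν => lam ν ^ (-γ)))
    (htails : UniformlySummableTails γ Λ) :
    (∀ s : ℂ, γ < s.re →
        Tendsto (fun n => ∑' ν, (Λ n ν : ℂ) ^ (-s)) atTop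
          (𝓝 (∑' ν, (lam ν : ℂ) ^ (-s)))) ↔
      Tendsto (fun n => ∑' ν, |Λ n ν ^ (-γ) - lam ν ^ (-γ)|) atTop (𝓝 0) := by
  have ha : ∀ n ν, 0 < Λ n ν ^ (-γ) := fun n ν => Real.rpow_pos_of_pos (hΛpos n ν) _
  have hb : ∀ ν, 0 < lam ν ^ (-γ) := fun ν => Real.rpow_pos_of_pos (hlampos ν) _
  have ha_anti : ∀ n, Antitone fun ν => Λ n ν ^ (-γ) := fun n i j hij =>
    Real.rpow_le_rpow_of_nonpos (hΛpos n i) (hΛmono n hij) (neg_nonpos.2 hγ.le)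
  have hb_anti : Antitone fun ν => lam ν ^ (-γ) := fun i j hij =>
    Real.rpow_le_rpow_of_nonpos (hlampos i) (hlammono hij) (neg_nonpos.2 hγ.le)
  have hsq : ∀ {b : ℕ → ℝ}, (∀ ν, 0 < b ν) → Antitone b → Summable b →
      Summable fun ν => b ν ^ 2 := fun {b} hpos hanti hs =>
    .of_nonneg_of_le (fun ν => sq_nonneg _) (fun ν => by
      rw [sq]
      exact mul_le_mul_of_nonneg_right (hanti ν.zero_le) (hpos ν).le) (hs.mul_left (b 0))
  simp_rw [fun s n ν => ofReal_cpow_neg_eq hγ.ne' (hΛpos n ν) s,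
    fun s ν => ofReal_cpow_neg_eq hγ.ne' (hlampos ν) s]
  constructor
  · intro h
    refine tendsto_tsum_abs_sub_of_tails (fun n ν => (ha n ν).le) (fun ν => (hb ν).le) hsum hsuml
      htails fun ν => ?_
    refine tendsto_apply_of_tendsto_tsum_pow ν (a := fun n ν => Λ n ν ^ (-γ))
      (b := fun ν => lam ν ^ (-γ)) (fun n ν => (ha n ν).le) hb ha_anti hb_anti
      (fun n => hsq (ha n) (ha_anti n) (hsum n)) (hsq hb hb_anti hsuml) fun m => ?_
    have hm : γ < (((m + 2 : ℕ) : ℂ) * (γ : ℂ)).re := by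
      rw [← Complex.ofReal_natCast, ← Complex.ofReal_mul, Complex.ofReal_re]
      push_cast
      nlinarith [(Nat.cast_nonneg m : (0 : ℝ) ≤ m)]
    have key := h _ hm
    simp_rw [mul_div_cancel_right₀ _ (Complex.ofReal_ne_zero.2 hγ.ne'), Complex.cpow_natCast,
      ← Complex.ofReal_pow, ← Complex.ofReal_tsum] at key
    exact (Complex.continuous_re.tendsto _).comp key
  · intro h s hs
    refine tendsto_tsum_cpow_of_tendsto_l1 ?_ ha hb ha_anti hb_anti hsum hsuml h
    rw [Complex.div_ofReal_re, one_le_div hγ]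
    exact hs.le
end

section
/- Let γ>0. For each n∈ℕ let Λ_n=(λ_{n,ν})_{ν≥1} and let Λ=(λ_ν)_{ν≥1} be nondecreasing sequences of positive real numbers such that ∑_{ν≥1} λ_ν^{−γ} < ∞, such that ∑_{ν≥1} λ_{n,ν}^{−γ} < ∞ for every n, and such that the family (Λ_n) has uniformly summable tails at γ. Suppose that D_{Λ_n}(s) → D_Λ(s) as n→∞ for every s∈ℂ with Re(s)>γ, and that for each fixed ν the sequence (λ_{n,ν})_{n∈ℕ} is bounded. Then for every ν one has lim_{n→∞} λ_{n,ν} = λ_ν. -/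
open Filter Topology

/-- Geometric decay beats constants: the Dirichlet weight of a larger base is eventually
negligible against that of a smaller one. -/
theorem exists_rpow_neg_mul_lt {a b : ℝ} (ha : 0 < a) (hab : a < b) (γ C : ℝ) :
    ∃ s, γ < s ∧ b ^ (-(s - γ)) * C < a ^ (-s) := by
  have hb : 0 < b := ha.trans hab
  have hlim : Tendsto (fun s : ℝ => (a / b) ^ s * (b ^ γ * C)) atTop (𝓝 0) := by
    simpa using (tendsto_rpow_atTop_of_base_lt_one (a / b)
      (by linarith [div_pos ha hb]) ((div_lt_one hb).2 hab)).mul_const (b ^ γ * C)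
  obtain ⟨s, hs, hγs⟩ := ((hlim.eventually_lt_const one_pos).and (eventually_gt_atTop γ)).exists
  refine ⟨s, hγs, ?_⟩
  have has : 0 < a ^ s := Real.rpow_pos_of_pos ha s
  have hbs : 0 < b ^ s := Real.rpow_pos_of_pos hb s
  rw [Real.div_rpow ha.le hb.le] at hs
  rw [neg_sub, Real.rpow_sub hb, Real.rpow_neg ha.le, ← one_div, lt_div_iff₀ has]
  calc b ^ γ / b ^ s * C * a ^ s = a ^ s / b ^ s * (b ^ γ * C) := by ring
    _ < 1 := hs

section Monotone

variable {f : ℕ → ℝ} {γ s : ℝ}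

theorem rpow_neg_le_of_monotone (hpos : ∀ ν, 0 < f ν) (hmono : Monotone f) (hs : γ ≤ s) (ν : ℕ) :
    f ν ^ (-s) ≤ f 0 ^ (-(s - γ)) * f ν ^ (-γ) := by
  have hsplit : f ν ^ (-s) = f ν ^ (-(s - γ)) * f ν ^ (-γ) := by
    rw [← Real.rpow_add (hpos ν)]
    ring_nf
  rw [hsplit]
  exact mul_le_mul_of_nonneg_right
    (Real.rpow_le_rpow_of_nonpos (hpos 0) (hmono (Nat.zero_le ν)) (by linarith))
    (Real.rpow_nonneg (hpos ν).le _)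

theorem summable_rpow_neg_of_le (hpos : ∀ ν, 0 < f ν) (hmono : Monotone f)
    (hsum : Summable fun ν => f ν ^ (-γ)) (hs : γ ≤ s) : Summable fun ν => f ν ^ (-s) :=
  .of_nonneg_of_le (fun ν => Real.rpow_nonneg (hpos ν).le _)
    (rpow_neg_le_of_monotone hpos hmono hs) (hsum.mul_left _)

theorem tsum_rpow_neg_le (hpos : ∀ ν, 0 < f ν) (hmono : Monotone f)
    (hsum : Summable fun ν => f ν ^ (-γ)) (hs : γ ≤ s) :
    ∑' ν, f ν ^ (-s) ≤ f 0 ^ (-(s - γ)) * ∑' ν, f ν ^ (-γ) := by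
  rw [← tsum_mul_left]
  exact (summable_rpow_neg_of_le hpos hmono hsum hs).tsum_le_tsum
    (rpow_neg_le_of_monotone hpos hmono hs) (hsum.mul_left _)

theorem rpow_neg_zero_le_tsum (hpos : ∀ ν, 0 < f ν) (hmono : Monotone f)
    (hsum : Summable fun ν => f ν ^ (-γ)) (hs : γ ≤ s) : f 0 ^ (-s) ≤ ∑' ν, f ν ^ (-s) :=
  (summable_rpow_neg_of_le hpos hmono hsum hs).le_tsum 0
    fun ν _ => Real.rpow_nonneg (hpos ν).le _

end Monotone

/-- The first terms converge if the Dirichlet series converge at large real arguments and are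
uniformly bounded at `γ`. -/
theorem tendsto_zero_of_tendsto_tsum_rpow_neg {F : ℕ → ℕ → ℝ} {g : ℕ → ℝ} {γ B : ℝ} (hγ : 0 < γ)
    (hFpos : ∀ n ν, 0 < F n ν) (hFmono : ∀ n, Monotone (F n))
    (hgpos : ∀ ν, 0 < g ν) (hgmono : Monotone g)
    (hFsum : ∀ n, Summable fun ν => F n ν ^ (-γ)) (hgsum : Summable fun ν => g ν ^ (-γ))
    (hB : ∀ n, ∑' ν, F n ν ^ (-γ) ≤ B)
    (hconv : ∀ s, γ < s →
      Tendsto (fun n => ∑' ν, F n ν ^ (-s)) atTop (𝓝 (∑' ν, g ν ^ (-s)))) :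
    Tendsto (fun n => F n 0) atTop (𝓝 (g 0)) := by
  refine tendsto_order.2 ⟨fun a ha => ?_, fun a ha => ?_⟩
  · rcases le_or_gt a 0 with ha0 | ha0
    · exact .of_forall fun n => ha0.trans_lt (hFpos n 0)
    obtain ⟨s, hγs, hs⟩ := exists_rpow_neg_mul_lt ha0 ha γ (∑' ν, g ν ^ (-γ))
    filter_upwards [(hconv s hγs).eventually_lt_const
      ((tsum_rpow_neg_le hgpos hgmono hgsum hγs.le).trans_lt hs)] with n hn
    by_contra! hle
    have h1 := rpow_neg_zero_le_tsum (hFpos n) (hFmono n) (hFsum n) hγs.le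
    have h2 : a ^ (-s) ≤ F n 0 ^ (-s) :=
      Real.rpow_le_rpow_of_nonpos (hFpos n 0) hle (by linarith)
    linarith
  · obtain ⟨s, hγs, hs⟩ := exists_rpow_neg_mul_lt (hgpos 0) ha γ B
    filter_upwards [(hconv s hγs).eventually_const_lt
      (hs.trans_le (rpow_neg_zero_le_tsum hgpos hgmono hgsum hγs.le))] with n hn
    by_contra! hle
    have ha0 : 0 < a := (hgpos 0).trans ha
    have h1 := tsum_rpow_neg_le (hFpos n) (hFmono n) (hFsum n) hγs.le
    have h2 : F n 0 ^ (-(s - γ)) * ∑' ν, F n ν ^ (-γ) ≤ a ^ (-(s - γ)) * B :=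
      mul_le_mul (Real.rpow_le_rpow_of_nonpos ha0 hle (by linarith)) (hB n)
        (tsum_nonneg fun ν => Real.rpow_nonneg (hFpos n ν).le _) (Real.rpow_nonneg ha0.le _)
    linarith

theorem ofReal_tsum_rpow_neg {f : ℕ → ℝ} (hpos : ∀ ν, 0 < f ν) (s : ℝ) :
    ∑' ν, (f ν : ℂ) ^ (-(s : ℂ)) = ((∑' ν, f ν ^ (-s) : ℝ) : ℂ) := by
  rw [Complex.ofReal_tsum]
  refine tsum_congr fun ν => ?_
  rw [Complex.ofReal_cpow (hpos ν).le]
  simp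

/-- Uniformly summable tails and a uniform bound on one Dirichlet series value give a uniform
bound on the Dirichlet series at `γ`. -/
theorem UniformlySummableTails.exists_tsum_le {γ s M : ℝ} {Λ : ℕ → ℕ → ℝ} (hγ : 0 < γ)
    (htails : UniformlySummableTails γ Λ) (hpos : ∀ n ν, 0 < Λ n ν) (hmono : ∀ n, Monotone (Λ n))
    (hsum : ∀ n, Summable fun ν => Λ n ν ^ (-γ)) (hs : γ ≤ s)
    (hM : ∀ n, ∑' ν, Λ n ν ^ (-s) ≤ M) : ∃ B, ∀ n, ∑' ν, Λ n ν ^ (-γ) ≤ B := by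
  obtain ⟨N, hN⟩ := htails 1 one_pos
  have hs0 : 0 < s := hγ.trans_le hs
  have hterm : ∀ n ν, Λ n ν ^ (-γ) ≤ M ^ (γ / s) := fun n ν => by
    calc Λ n ν ^ (-γ) ≤ Λ n 0 ^ (-γ) :=
          Real.rpow_le_rpow_of_nonpos (hpos n 0) (hmono n (Nat.zero_le ν)) (by linarith)
      _ = (Λ n 0 ^ (-s)) ^ (γ / s) := by
          rw [← Real.rpow_mul (hpos n 0).le]
          congr 1
          field_simp
      _ ≤ M ^ (γ / s) :=
          Real.rpow_le_rpow (Real.rpow_nonneg (hpos n 0).le _)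
            ((rpow_neg_zero_le_tsum (hpos n) (hmono n) (hsum n) hs).trans (hM n))
            (by positivity)
  refine ⟨N * M ^ (γ / s) + 1, fun n => ?_⟩
  rw [← (hsum n).sum_add_tsum_nat_add N]
  refine add_le_add ?_ ?_
  · simpa using Finset.sum_le_sum fun ν (_ : ν ∈ Finset.range N) => hterm n ν
  · simpa only [add_comm N] using (hN n).le

/-- if the Dirichlet series converge pointwise on `Re s > γ` and each sequence
`(λ_{n,ν})_n` is bounded, then `λ_{n,ν} → λ_ν` for every `ν`. -/
theorem eigenvalues_tendsto_of_dirichlet_series_tendsto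
    (γ : ℝ) (hγ : 0 < γ)
    (Λ : ℕ → ℕ → ℝ) (lam : ℕ → ℝ)
    (hΛpos : ∀ n ν, 0 < Λ n ν) (hΛmono : ∀ n, Monotone (Λ n))
    (hlampos : ∀ ν, 0 < lam ν) (hlammono : Monotone lam)
    (hsum : ∀ n, Summable (fun ν => Λ n ν ^ (-γ)))
    (hsuml : Summable (fun ν => lam ν ^ (-γ)))
    (htails : UniformlySummableTails γ Λ)
    (hconv : ∀ s : ℂ, γ < s.re →
        Tendsto (fun n => ∑' ν, (Λ n ν : ℂ) ^ (-s)) atTop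
          (𝓝 (∑' ν, (lam ν : ℂ) ^ (-s))))
    (hbdd : ∀ ν, ∃ C : ℝ, ∀ n, Λ n ν ≤ C) :
    ∀ ν, Tendsto (fun n => Λ n ν) atTop (𝓝 (lam ν)) := by
  have hconvR : ∀ s : ℝ, γ < s →
      Tendsto (fun n => ∑' ν, Λ n ν ^ (-s)) atTop (𝓝 (∑' ν, lam ν ^ (-s))) := fun s hs => by
    have h := hconv s (by simpa using hs)
    simp only [ofReal_tsum_rpow_neg (hΛpos _), ofReal_tsum_rpow_neg hlampos] at h
    exact (Complex.continuous_re.tendsto _).comp h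
  obtain ⟨M, hM⟩ := (hconvR (γ + 1) (by linarith)).bddAbove_range
  obtain ⟨B, hB⟩ := htails.exists_tsum_le hγ hΛpos hΛmono hsum (s := γ + 1) (by linarith)
    fun n => hM ⟨n, rfl⟩
  have hshift : ∀ k : ℕ, Monotone fun ν : ℕ => ν + k := fun k _ _ h => Nat.add_le_add_right h k
  have hstep : ∀ k, (∀ s : ℝ, γ < s → Tendsto (fun n => ∑' ν, Λ n (ν + k) ^ (-s)) atTop
      (𝓝 (∑' ν, lam (ν + k) ^ (-s)))) → Tendsto (fun n => Λ n k) atTop (𝓝 (lam k)) :=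
    fun k hk => by
      have hBk : ∀ n, ∑' ν, Λ n (ν + k) ^ (-γ) ≤ B := fun n => by
        have hsplit := (hsum n).sum_add_tsum_nat_add k
        have hnonneg : 0 ≤ ∑ ν ∈ Finset.range k, Λ n ν ^ (-γ) :=
          Finset.sum_nonneg fun ν _ => Real.rpow_nonneg (hΛpos n ν).le _
        linarith [hB n]
      simpa using tendsto_zero_of_tendsto_tsum_rpow_neg (F := fun n ν => Λ n (ν + k))
        (g := fun ν => lam (ν + k)) hγ (fun n ν => hΛpos n _)
        (fun n => (hΛmono n).comp (hshift k)) (fun ν => hlampos _) (hlammono.comp (hshift k))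
        (fun n => (summable_nat_add_iff k).2 (hsum n)) ((summable_nat_add_iff k).2 hsuml) hBk hk
  intro k
  refine hstep k ?_
  induction k with
  | zero => simpa using hconvR
  | succ k ih =>
    intro s hs
    have hpeel : ∀ f : ℕ → ℝ, (∀ ν, 0 < f ν) → Monotone f → Summable (fun ν => f ν ^ (-γ)) →
        ∑' ν, f (ν + (k + 1)) ^ (-s) = ∑' ν, f (ν + k) ^ (-s) - f k ^ (-s) :=
      fun f hpos hmono hf => by
        have h := ((summable_nat_add_iff k).2
          (summable_rpow_neg_of_le hpos hmono hf hs.le)).tsum_eq_zero_add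
        simp only [zero_add] at h
        rw [h, add_sub_cancel_left]
        exact tsum_congr fun ν => by rw [add_right_comm, add_assoc]
    simp only [hpeel _ (hΛpos _) (hΛmono _) (hsum _), hpeel _ hlampos hlammono hsuml]
    exact (ih s hs).sub ((hstep k ih).rpow_const (Or.inl (hlampos k).ne'))
end

section
/- Fix γ>0 and let S_γ be the set of nondecreasing sequences Λ=(λ_ν)_{ν≥1} of positive real numbers such that the Dirichlet series D_Λ(s)=∑_{ν≥1} λ_ν^{−s} converges for every real s>γ. For Λ₁,Λ₂ ∈ S_γ define d(Λ₁,Λ₂) = sup_{γ<s<γ+1, s real} | log | D_{Λ₁}(s) / D_{Λ₂}(s) | | ∈ [0,∞]. Then d is an extended metric on S_γ: d(Λ₁,Λ₂)=0 if and only if Λ₁=Λ₂ (i.e. λ_{1,ν}=λ_{2,ν} for all ν), d(Λ₁,Λ₂)=d(Λ₂,Λ₁), and d(Λ₁,Λ₃) ≤ d(Λ₁,Λ₂)+d(Λ₂,Λ₃). -/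
open Filter Topology
open scoped ENNReal

/-- The Dirichlet series `D_Λ(s) = ∑_ν λ_ν^{-s}` of a sequence of positive reals,
for real `s`. -/
noncomputable def dirichletSeries (lam : ℕ → ℝ) (s : ℝ) : ℝ :=
  ∑' ν, lam ν ^ (-s)

/-- The spectral distance `d(Λ₁,Λ₂) = sup_{γ<s<γ+1} |log |D_{Λ₁}(s)/D_{Λ₂}(s)||`, valued in
the extended nonnegative reals `[0,∞]`. -/
noncomputable def spectralDist (γ : ℝ) (lam₁ lam₂ : ℕ → ℝ) : ℝ≥0∞ :=
  ⨆ s ∈ Set.Ioo γ (γ + 1),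
    ENNReal.ofReal |Real.log (dirichletSeries lam₁ s / dirichletSeries lam₂ s)|

/-- The complex function `z ↦ ∑_ν λ_ν^{-z}` extending a Dirichlet series to a half-plane. -/
noncomputable def complexDirichletSeries (lam : ℕ → ℝ) (z : ℂ) : ℂ :=
  ∑' ν, (lam ν : ℂ) ^ (-z)

theorem complexDirichletSeries_ofReal {lam : ℕ → ℝ} (hpos : ∀ ν, 0 < lam ν) (s : ℝ) :
    complexDirichletSeries lam s = dirichletSeries lam s := by
  rw [complexDirichletSeries, dirichletSeries, Complex.ofReal_tsum]
  refine tsum_congr fun ν => ?_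
  rw [Complex.ofReal_cpow (hpos ν).le, Complex.ofReal_neg]

theorem rpow_neg_le_add_of_mem_Icc {x a b t : ℝ} (hx : 0 < x) (ha : a ≤ t) (hb : t ≤ b) :
    x ^ (-t) ≤ x ^ (-a) + x ^ (-b) := by
  have h₁ := Real.rpow_nonneg hx.le (-a)
  have h₂ := Real.rpow_nonneg hx.le (-b)
  rcases le_total 1 x with h | h
  · linarith [Real.rpow_le_rpow_of_exponent_le h (neg_le_neg ha)]
  · linarith [Real.rpow_le_rpow_of_exponent_ge hx h (neg_le_neg hb)]

theorem differentiableOn_complexDirichletSeries {γ : ℝ} {lam : ℕ → ℝ} (hpos : ∀ ν, 0 < lam ν)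
    (hsum : ∀ s : ℝ, γ < s → Summable (fun ν => lam ν ^ (-s))) :
    DifferentiableOn ℂ (complexDirichletSeries lam) {z | γ < z.re} := by
  intro z hz
  obtain ⟨a, ha, haz⟩ := exists_between (show γ < z.re from hz)
  obtain ⟨b, hb⟩ := exists_gt z.re
  have hopen : IsOpen {w : ℂ | a < w.re ∧ w.re < b} :=
    (isOpen_lt continuous_const Complex.continuous_re).inter
      (isOpen_lt Complex.continuous_re continuous_const)
  have hd : DifferentiableOn ℂ (fun w : ℂ => ∑' ν, (lam ν : ℂ) ^ (-w))
      {w : ℂ | a < w.re ∧ w.re < b} := by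
    refine Complex.differentiableOn_tsum_of_summable_norm
      ((hsum a ha).add (hsum b (ha.trans (haz.trans hb)))) (fun ν => ?_) hopen ?_
    · intro w _
      have : (lam ν : ℂ) ≠ 0 := Complex.ofReal_ne_zero.mpr (hpos ν).ne'
      exact (differentiableAt_id.neg.const_cpow (Or.inl this)).differentiableWithinAt
    · intro ν w hw
      rw [Complex.norm_cpow_eq_rpow_re_of_pos (hpos ν), Complex.neg_re]
      exact rpow_neg_le_add_of_mem_Icc (hpos ν) hw.1.le hw.2.le
  exact (hd.differentiableAt (hopen.mem_nhds ⟨haz, hb⟩)).differentiableWithinAt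

/-- Two Dirichlet series that agree on an interval adjacent to the abscissa agree everywhere to
the right of it. -/
theorem dirichletSeries_eq_of_eqOn_Ioo {γ δ : ℝ} (hδ : γ < δ) {lam mu : ℕ → ℝ}
    (hlam : ∀ ν, 0 < lam ν) (hlam_sum : ∀ s : ℝ, γ < s → Summable (fun ν => lam ν ^ (-s)))
    (hmu : ∀ ν, 0 < mu ν) (hmu_sum : ∀ s : ℝ, γ < s → Summable (fun ν => mu ν ^ (-s)))
    (h : Set.EqOn (dirichletSeries lam) (dirichletSeries mu) (Set.Ioo γ δ))
    {s : ℝ} (hs : γ < s) : dirichletSeries lam s = dirichletSeries mu s := by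
  have hopen : IsOpen {z : ℂ | γ < z.re} := isOpen_lt continuous_const Complex.continuous_re
  have hconn : IsPreconnected {z : ℂ | γ < z.re} := (convex_halfSpace_re_gt γ).isPreconnected
  obtain ⟨c, hc, hcδ⟩ := exists_between hδ
  have hfreq : ∃ᶠ z in 𝓝[≠] (c : ℂ),
      complexDirichletSeries lam z = complexDirichletSeries mu z := by
    have ht : Tendsto (fun x : ℝ => (x : ℂ)) (𝓝[≠] c) (𝓝[≠] (c : ℂ)) :=
      Complex.continuous_ofReal.continuousAt.continuousWithinAt.tendsto_nhdsWithin
        fun x hx => by simpa using hx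
    refine ht.frequently (Eventually.frequently ?_)
    filter_upwards [mem_nhdsWithin_of_mem_nhds (Ioo_mem_nhds hc hcδ)] with x hx
    rw [complexDirichletSeries_ofReal hlam, complexDirichletSeries_ofReal hmu, h hx]
  have heq := AnalyticOnNhd.eqOn_of_preconnected_of_frequently_eq
    ((differentiableOn_complexDirichletSeries hlam hlam_sum).analyticOnNhd hopen)
    ((differentiableOn_complexDirichletSeries hmu hmu_sum).analyticOnNhd hopen)
    hconn (show (c : ℂ) ∈ {z : ℂ | γ < z.re} from by simpa using hc) hfreq
  have := heq (show (s : ℂ) ∈ {z : ℂ | γ < z.re} from by simpa using hs)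
  rw [complexDirichletSeries_ofReal hlam, complexDirichletSeries_ofReal hmu] at this
  exact_mod_cast this

theorem dirichletSeries_pos {lam : ℕ → ℝ} (hpos : ∀ ν, 0 < lam ν) {s : ℝ}
    (hsum : Summable (fun ν => lam ν ^ (-s))) : 0 < dirichletSeries lam s :=
  hsum.tsum_pos (fun ν => (Real.rpow_pos_of_pos (hpos ν) _).le) 0
    (Real.rpow_pos_of_pos (hpos 0) _)

/-- If the Dirichlet series of `lam` is dominated by that of `mu`, then every lower bound of `mu`
is a lower bound of `lam`. -/
theorem le_of_dirichletSeries_le {γ b : ℝ} {lam mu : ℕ → ℝ} (hb : 0 < b)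
    (hlam : ∀ ν, 0 < lam ν) (hlam_sum : ∀ s : ℝ, γ < s → Summable (fun ν => lam ν ^ (-s)))
    (hmu : ∀ ν, b ≤ mu ν) (hmu_sum : ∀ s : ℝ, γ < s → Summable (fun ν => mu ν ^ (-s)))
    (h : ∀ s : ℝ, γ < s → dirichletSeries lam s ≤ dirichletSeries mu s) (ν : ℕ) :
    b ≤ lam ν := by
  by_contra! hlt
  have hbound : ∀ n : ℕ, (b / lam ν) ^ n ≤
      dirichletSeries mu (γ + 1) / lam ν ^ (-(γ + 1)) := by
    intro n
    have hs : γ < γ + 1 + n := by linarith [n.cast_nonneg (α := ℝ)]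
    have h₁ : lam ν ^ (-(γ + 1 + n)) ≤ dirichletSeries lam (γ + 1 + n) :=
      (hlam_sum _ hs).le_tsum ν fun j _ => (Real.rpow_pos_of_pos (hlam j) _).le
    have h₂ : dirichletSeries mu (γ + 1 + n) ≤ dirichletSeries mu (γ + 1) * (b ^ n)⁻¹ := by
      rw [dirichletSeries, dirichletSeries, ← tsum_mul_right]
      refine (hmu_sum _ hs).tsum_le_tsum (fun j => ?_) ((hmu_sum _ (lt_add_one γ)).mul_right _)
      have hj : 0 < mu j := hb.trans_le (hmu j)
      rw [neg_add, Real.rpow_add hj, Real.rpow_neg hj.le n, Real.rpow_natCast]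
      have := Real.rpow_pos_of_pos hj (-(γ + 1))
      gcongr
      exact hmu j
    have h₃ := h₁.trans ((h _ hs).trans h₂)
    rw [neg_add, Real.rpow_add (hlam ν), Real.rpow_neg (hlam ν).le n, Real.rpow_natCast] at h₃
    have hl := Real.rpow_pos_of_pos (hlam ν) (-(γ + 1))
    have hn := pow_pos (hlam ν) n
    have hbn := pow_pos hb n
    rw [← div_eq_mul_inv, ← div_eq_mul_inv, div_le_div_iff₀ hn hbn] at h₃
    rw [div_pow, div_le_div_iff₀ hn hl]
    linarith
  obtain ⟨n, hn⟩ := pow_unbounded_of_one_lt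
    (dirichletSeries mu (γ + 1) / lam ν ^ (-(γ + 1))) ((one_lt_div (hlam ν)).mpr hlt)
  exact (hbound n).not_gt hn

/-- A nondecreasing sequence of positive reals is determined by its Dirichlet series. -/
theorem eq_of_dirichletSeries_eq {γ : ℝ} {lam mu : ℕ → ℝ}
    (hlam : ∀ ν, 0 < lam ν) (hlam_mono : Monotone lam)
    (hlam_sum : ∀ s : ℝ, γ < s → Summable (fun ν => lam ν ^ (-s)))
    (hmu : ∀ ν, 0 < mu ν) (hmu_mono : Monotone mu)
    (hmu_sum : ∀ s : ℝ, γ < s → Summable (fun ν => mu ν ^ (-s)))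
    (h : ∀ s : ℝ, γ < s → dirichletSeries lam s = dirichletSeries mu s) : lam = mu := by
  funext n
  induction n using Nat.strong_induction_on with
  | _ n ih =>
    have hlam_tail : ∀ s : ℝ, γ < s → Summable (fun ν => lam (ν + n) ^ (-s)) := fun s hs =>
      (summable_nat_add_iff n).mpr (hlam_sum s hs)
    have hmu_tail : ∀ s : ℝ, γ < s → Summable (fun ν => mu (ν + n) ^ (-s)) := fun s hs =>
      (summable_nat_add_iff n).mpr (hmu_sum s hs)
    have htail : ∀ s : ℝ, γ < s → dirichletSeries (fun ν => lam (ν + n)) s =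
        dirichletSeries (fun ν => mu (ν + n)) s := by
      intro s hs
      have h₁ := (hlam_sum s hs).sum_add_tsum_nat_add n
      have h₂ := (hmu_sum s hs).sum_add_tsum_nat_add n
      have h₃ : ∑ i ∈ Finset.range n, lam i ^ (-s) = ∑ i ∈ Finset.range n, mu i ^ (-s) :=
        Finset.sum_congr rfl fun i hi => by rw [ih i (Finset.mem_range.mp hi)]
      have h₄ := h s hs
      simp only [dirichletSeries] at h₄ ⊢
      linarith
    apply le_antisymm
    · simpa using le_of_dirichletSeries_le (hlam n) (fun ν => hmu (ν + n)) hmu_tail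
        (fun ν => hlam_mono (Nat.le_add_left n ν)) hlam_tail (fun s hs => (htail s hs).ge) 0
    · simpa using le_of_dirichletSeries_le (hmu n) (fun ν => hlam (ν + n)) hlam_tail
        (fun ν => hmu_mono (Nat.le_add_left n ν)) hmu_tail (fun s hs => (htail s hs).le) 0

theorem spectralDist_comm (γ : ℝ) (lam mu : ℕ → ℝ) :
    spectralDist γ lam mu = spectralDist γ mu lam := by
  simp only [spectralDist]
  refine iSup_congr fun s => iSup_congr fun _ => ?_
  rw [← inv_div, Real.log_inv, abs_neg]

/-- on the set of nondecreasing sequences of positive reals whose Dirichlet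
series converges for all real `s > γ`, `spectralDist` is an extended metric. -/
theorem spectralDist_is_extended_metric
    (γ : ℝ) (hγ : 0 < γ)
    (lam₁ lam₂ lam₃ : ℕ → ℝ)
    (hpos₁ : ∀ ν, 0 < lam₁ ν) (hmono₁ : Monotone lam₁)
    (hsum₁ : ∀ s : ℝ, γ < s → Summable (fun ν => lam₁ ν ^ (-s)))
    (hpos₂ : ∀ ν, 0 < lam₂ ν) (hmono₂ : Monotone lam₂)
    (hsum₂ : ∀ s : ℝ, γ < s → Summable (fun ν => lam₂ ν ^ (-s)))
    (hpos₃ : ∀ ν, 0 < lam₃ ν) (hmono₃ : Monotone lam₃)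
    (hsum₃ : ∀ s : ℝ, γ < s → Summable (fun ν => lam₃ ν ^ (-s))) :
    (spectralDist γ lam₁ lam₂ = 0 ↔ lam₁ = lam₂) ∧
    spectralDist γ lam₁ lam₂ = spectralDist γ lam₂ lam₁ ∧
    spectralDist γ lam₁ lam₃ ≤ spectralDist γ lam₁ lam₂ + spectralDist γ lam₂ lam₃ := by
  have hD₁ := fun s (hs : γ < s) => dirichletSeries_pos hpos₁ (hsum₁ s hs)
  have hD₂ := fun s (hs : γ < s) => dirichletSeries_pos hpos₂ (hsum₂ s hs)
  have hD₃ := fun s (hs : γ < s) => dirichletSeries_pos hpos₃ (hsum₃ s hs)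
  refine ⟨⟨fun h => ?_, ?_⟩, spectralDist_comm γ lam₁ lam₂, ?_⟩
  · have heq : Set.EqOn (dirichletSeries lam₁) (dirichletSeries lam₂) (Set.Ioo γ (γ + 1)) := by
      intro s hs
      have hlog : Real.log (dirichletSeries lam₁ s / dirichletSeries lam₂ s) = 0 := by
        simp only [spectralDist, ENNReal.iSup_eq_zero, ENNReal.ofReal_eq_zero] at h
        exact abs_nonpos_iff.mp (h s hs)
      have hone := Real.eq_one_of_pos_of_log_eq_zero (div_pos (hD₁ s hs.1) (hD₂ s hs.1)) hlog
      exact (div_eq_one_iff_eq (hD₂ s hs.1).ne').mp hone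
    exact eq_of_dirichletSeries_eq hpos₁ hmono₁ hsum₁ hpos₂ hmono₂ hsum₂ fun s hs =>
      dirichletSeries_eq_of_eqOn_Ioo (lt_add_one γ) hpos₁ hsum₁ hpos₂ hsum₂ heq hs
  · rintro rfl
    simp only [spectralDist, ENNReal.iSup_eq_zero, ENNReal.ofReal_eq_zero]
    intro s hs
    rw [div_self (hD₁ s hs.1).ne', Real.log_one, abs_zero]
  · refine iSup₂_le fun s hs => ?_
    have hlog : Real.log (dirichletSeries lam₁ s / dirichletSeries lam₃ s) =
        Real.log (dirichletSeries lam₁ s / dirichletSeries lam₂ s) +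
          Real.log (dirichletSeries lam₂ s / dirichletSeries lam₃ s) := by
      rw [← Real.log_mul (div_pos (hD₁ s hs.1) (hD₂ s hs.1)).ne'
        (div_pos (hD₂ s hs.1) (hD₃ s hs.1)).ne', div_mul_div_cancel₀ (hD₂ s hs.1).ne']
    rw [hlog]
    refine (ENNReal.ofReal_le_ofReal (abs_add_le _ _)).trans (ENNReal.ofReal_add_le.trans ?_)
    exact add_le_add
      (le_iSup₂ (f := fun s (_ : s ∈ Set.Ioo γ (γ + 1)) =>
        ENNReal.ofReal |Real.log (dirichletSeries lam₁ s / dirichletSeries lam₂ s)|) s hs)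
      (le_iSup₂ (f := fun s (_ : s ∈ Set.Ioo γ (γ + 1)) =>
        ENNReal.ofReal |Real.log (dirichletSeries lam₂ s / dirichletSeries lam₃ s)|) s hs)
end

section
/- Let (μ_ν)_{ν≥1} be a strictly increasing sequence of real numbers and let σ₁ ∈ ℝ. For each n∈ℕ let (a_{n,ν})_{ν≥1} and let (a_ν)_{ν≥1} be complex coefficients with ∑_{ν≥1} |a_{n,ν}| e^{−σ₁ μ_ν} < ∞ for every n and ∑_{ν≥1} |a_ν| e^{−σ₁ μ_ν} < ∞, and set D_n(s)=∑_{ν≥1} a_{n,ν} e^{−s μ_ν} and D(s)=∑_{ν≥1} a_ν e^{−s μ_ν}. If D_n converges to D uniformly on the vertical line Re(s)=σ₁, i.e. sup_{t∈ℝ} |D_n(σ₁+it) − D(σ₁+it)| → 0 as n→∞, then sup_{ν≥1} |a_{n,ν} − a_ν| e^{−σ₁ μ_ν} → 0 as n→∞; in particular, for every fixed ν, a_{n,ν} → a_ν as n→∞. -/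
open Filter Topology Complex

/-- The mean of `t ↦ exp (x t I)` over `[0, T]` tends to `0` for every nonzero frequency `x`. -/
lemma tendsto_mean_exp_of_ne_zero {x : ℝ} (hx : x ≠ 0) :
    Tendsto (fun T : ℝ => (T : ℂ)⁻¹ * ∫ t in (0 : ℝ)..T, exp (x * I * t)) atTop (𝓝 0) := by
  have hxI : (x : ℂ) * I ≠ 0 := mul_ne_zero (by exact_mod_cast hx) I_ne_zero
  have hbound : ∀ T : ℝ, 0 < T →
      ‖(T : ℂ)⁻¹ * ∫ t in (0 : ℝ)..T, exp (x * I * t)‖ ≤ T⁻¹ * (2 / |x|) := by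
    intro T hT
    have hexp : ‖exp (x * I * T)‖ = 1 := by
      have : (x : ℂ) * I * T = ((x * T : ℝ) : ℂ) * I := by push_cast; ring
      rw [this, norm_exp_ofReal_mul_I]
    rw [integral_exp_mul_complex hxI, norm_mul, norm_inv, norm_real, Real.norm_of_nonneg hT.le,
      norm_div, norm_mul, norm_I, mul_one, norm_real, Real.norm_eq_abs]
    gcongr
    refine (norm_sub_le _ _).trans ?_
    rw [hexp]
    norm_num
  refine squeeze_zero_norm' ((eventually_gt_atTop 0).mono hbound) ?_
  simpa using tendsto_inv_atTop_zero.mul_const (2 / |x|)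

/-- A coefficient of an absolutely convergent generalized trigonometric series is bounded by any
uniform bound for the series. -/
lemma norm_coeff_le_of_norm_tsum_le {ι : Type*} [Countable ι] {c : ι → ℂ}
    (hc : Summable fun i => ‖c i‖) {x : ι → ℝ} (hx : Function.Injective x) {ε : ℝ}
    (hε : ∀ t : ℝ, ‖∑' i, c i * exp (x i * I * t)‖ ≤ ε) (k : ι) : ‖c k‖ ≤ ε := by
  classical
  have hnorm : ∀ (y t : ℝ), ‖exp (y * I * t)‖ = 1 := by
    intro y t
    have : (y : ℂ) * I * t = ((y * t : ℝ) : ℂ) * I := by push_cast; ring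
    rw [this, norm_exp_ofReal_mul_I]
  set y : ι → ℝ := fun i => x i - x k with hy
  have hε' : ∀ t : ℝ, ‖∑' i, c i * exp (y i * I * t)‖ ≤ ε := by
    intro t
    have : ∑' i, c i * exp (y i * I * t)
        = (∑' i, c i * exp (x i * I * t)) * exp ((-x k : ℝ) * I * t) := by
      rw [← tsum_mul_right]
      refine tsum_congr fun i => ?_
      rw [mul_assoc (c i), ← Complex.exp_add]
      congr 2
      simp only [hy]
      push_cast
      ring
    rw [this, norm_mul, hnorm, mul_one]
    exact hε t
  have hmean : ∀ T : ℝ, ∑' i, c i * ((T : ℂ)⁻¹ * ∫ t in (0 : ℝ)..T, exp (y i * I * t))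
      = (T : ℂ)⁻¹ * ∫ t in (0 : ℝ)..T, ∑' i, c i * exp (y i * I * t) := by
    intro T
    have hsum := intervalIntegral.hasSum_integral_of_dominated_convergence
      (μ := MeasureTheory.volume) (a := 0) (b := T)
      (F := fun i (t : ℝ) => c i * exp (y i * I * t))
      (f := fun t : ℝ => ∑' i, c i * exp (y i * I * t)) (fun i _ => ‖c i‖)
      (fun i => (by fun_prop : Continuous _).aestronglyMeasurable)
      (fun i => .of_forall fun t _ => by rw [norm_mul, hnorm, mul_one])
      (.of_forall fun t _ => hc)
      intervalIntegrable_const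
      (.of_forall fun t _ => (Summable.of_norm (by simpa [hnorm] using hc)).hasSum)
    rw [← hsum.tsum_eq, ← tsum_mul_left]
    refine tsum_congr fun i => ?_
    rw [intervalIntegral.integral_const_mul]
    ring
  have hlim : Tendsto
      (fun T : ℝ => ∑' i, c i * ((T : ℂ)⁻¹ * ∫ t in (0 : ℝ)..T, exp (y i * I * t))) atTop
      (𝓝 (∑' i, if i = k then c k else 0)) := by
    refine tendsto_tsum_of_dominated_convergence hc (fun i => ?_) ?_
    · by_cases hik : i = k
      · subst hik
        refine tendsto_const_nhds.congr' ?_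
        filter_upwards [eventually_gt_atTop (0 : ℝ)] with T hT
        have : (T : ℂ) ≠ 0 := by exact_mod_cast hT.ne'
        simp [hy, this]
      · have hne : y i ≠ 0 := sub_ne_zero.mpr fun h => hik (hx h)
        simpa [hik] using (tendsto_mean_exp_of_ne_zero hne).const_mul (c i)
    · filter_upwards [eventually_gt_atTop (0 : ℝ)] with T hT i
      have h := intervalIntegral.norm_integral_le_of_norm_le_const (a := 0) (b := T)
        (f := fun t : ℝ => exp (y i * I * t)) (C := 1) fun t _ => (hnorm _ _).le
      rw [sub_zero, abs_of_pos hT, one_mul] at h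
      rw [norm_mul, norm_mul, norm_inv, norm_real, Real.norm_of_nonneg hT.le]
      exact mul_le_of_le_one_right (norm_nonneg _) (inv_mul_le_one_of_le₀ h hT.le)
  rw [tsum_ite_eq] at hlim
  refine le_of_tendsto hlim.norm ?_
  filter_upwards [eventually_gt_atTop (0 : ℝ)] with T hT
  have h := intervalIntegral.norm_integral_le_of_norm_le_const (a := 0) (b := T) fun t _ => hε' t
  rw [sub_zero, abs_of_pos hT] at h
  rw [hmean, norm_mul, norm_inv, norm_real, Real.norm_of_nonneg hT.le, inv_mul_le_iff₀ hT]
  linarith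

/-- for general Dirichlet series with common exponents `μ_ν`, uniform
convergence `D_n → D` on the vertical line `Re s = σ₁` implies
`sup_ν |a_{n,ν} - a_ν| e^{-σ₁ μ_ν} → 0`; in particular `a_{n,ν} → a_ν` for each `ν`. -/
theorem coefficients_tendsto_of_uniform_convergence_on_line
    (μ : ℕ → ℝ) (hμ : StrictMono μ) (σ₁ : ℝ)
    (a : ℕ → ℕ → ℂ) (b : ℕ → ℂ)
    (hsa : ∀ n, Summable (fun ν => ‖a n ν‖ * Real.exp (-σ₁ * μ ν)))
    (hsb : Summable (fun ν => ‖b ν‖ * Real.exp (-σ₁ * μ ν)))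
    (hconv : TendstoUniformly
      (fun n (t : ℝ) => ∑' ν, a n ν * Complex.exp (-(σ₁ + t * Complex.I) * μ ν))
      (fun (t : ℝ) => ∑' ν, b ν * Complex.exp (-(σ₁ + t * Complex.I) * μ ν))
      atTop) :
    TendstoUniformly
        (fun n ν => (a n ν - b ν) * (Real.exp (-σ₁ * μ ν) : ℂ))
        (fun _ => 0) atTop ∧
      ∀ ν, Tendsto (fun n => a n ν) atTop (𝓝 (b ν)) := by
  have hterm : ∀ (c : ℂ) (ν : ℕ) (t : ℝ), c * exp (-(σ₁ + t * I) * μ ν)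
      = c * (Real.exp (-σ₁ * μ ν) : ℂ) * exp ((-μ ν : ℝ) * I * t) := by
    intro c ν t
    rw [ofReal_exp, mul_assoc, ← Complex.exp_add]
    congr 2
    push_cast
    ring
  have hnorm : ∀ (c : ℂ) (ν : ℕ),
      ‖c * (Real.exp (-σ₁ * μ ν) : ℂ)‖ = ‖c‖ * Real.exp (-σ₁ * μ ν) := by
    intro c ν
    rw [norm_mul, norm_real, Real.norm_of_nonneg (Real.exp_pos _).le]
  have hsummable : ∀ {c : ℕ → ℂ}, Summable (fun ν => ‖c ν‖ * Real.exp (-σ₁ * μ ν)) →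
      ∀ t : ℝ, Summable fun ν => c ν * exp (-(σ₁ + t * I) * μ ν) := by
    intro c hc t
    refine Summable.of_norm (hc.congr fun ν => ?_)
    have : ((-μ ν : ℝ) : ℂ) * I * t = ((-μ ν * t : ℝ) : ℂ) * I := by push_cast; ring
    rw [hterm, norm_mul, hnorm, this, norm_exp_ofReal_mul_I, mul_one]
  have hunif : TendstoUniformly
      (fun n ν => (a n ν - b ν) * (Real.exp (-σ₁ * μ ν) : ℂ)) (fun _ => 0) atTop := by
    rw [Metric.tendstoUniformly_iff] at hconv ⊢
    intro ε hε
    filter_upwards [hconv (ε / 2) (half_pos hε)] with n hn ν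
    rw [dist_zero_left]
    refine lt_of_le_of_lt ?_ (half_lt_self hε)
    refine norm_coeff_le_of_norm_tsum_le (c := fun ν => (a n ν - b ν) * (Real.exp (-σ₁ * μ ν) : ℂ))
      (x := fun ν => -μ ν) ?_ (fun i j h => hμ.injective (neg_injective h)) (fun t => ?_) ν
    · refine Summable.of_nonneg_of_le (fun _ => norm_nonneg _) (fun ν => ?_) ((hsa n).add hsb)
      rw [hnorm, ← add_mul]
      exact mul_le_mul_of_nonneg_right (norm_sub_le _ _) (Real.exp_pos _).le
    · have h := (hn t).le
      rw [dist_comm, dist_eq_norm, ← (hsummable (hsa n) t).tsum_sub (hsummable hsb t)] at h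
      refine le_of_eq_of_le (congrArg _ (tsum_congr fun ν => ?_)) h
      rw [← hterm, sub_mul]
  refine ⟨hunif, fun ν => ?_⟩
  have hne : (Real.exp (-σ₁ * μ ν) : ℂ) ≠ 0 := by exact_mod_cast (Real.exp_pos _).ne'
  have h := ((hunif.tendsto_at ν).mul_const (Real.exp (-σ₁ * μ ν) : ℂ)⁻¹).add_const (b ν)
  simpa [mul_assoc, hne] using h
end

section
/- Let (μ_ν)_{ν≥1} be a strictly increasing sequence of real numbers, let (a_ν)_{ν≥1} be complex numbers, and let σ ∈ ℝ be such that ∑_{ν≥1} |a_ν| e^{−σ μ_ν} < ∞; set D(s)=∑_{ν≥1} a_ν e^{−s μ_ν}. Then for every κ≥1 one has a_κ e^{−σ μ_κ} = lim_{T→∞} (1/T) ∫_0^T D(σ+it) e^{i μ_κ t} dt. -/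
open Filter Topology Complex

/-- The mean value over `[0, T]` of the character `t ↦ e^{iwt}` has norm at most one. -/
lemma norm_mean_exp_le_one (w T : ℝ) (hT : 0 < T) :
    ‖(T : ℂ)⁻¹ * ∫ t in (0:ℝ)..T, Complex.exp (Complex.I * w * t)‖ ≤ 1 := by
  have h : ‖∫ t in (0:ℝ)..T, Complex.exp (Complex.I * w * t)‖ ≤ 1 * |T - 0| := by
    refine intervalIntegral.norm_integral_le_of_norm_le_const fun t _ => ?_
    simp [Complex.norm_exp]
  rw [sub_zero, one_mul, abs_of_pos hT] at h
  rw [norm_mul, norm_inv, Complex.norm_real, Real.norm_of_nonneg hT.le]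
  calc T⁻¹ * _ ≤ T⁻¹ * T := by gcongr
    _ = 1 := inv_mul_cancel₀ hT.ne'

/-- The character `t ↦ e^{iwt}` has mean value one if `w = 0` and zero otherwise. -/
lemma tendsto_mean_exp (w : ℝ) :
    Tendsto (fun T : ℝ => (T : ℂ)⁻¹ * ∫ t in (0:ℝ)..T, Complex.exp (Complex.I * w * t))
      atTop (𝓝 (if w = 0 then 1 else 0)) := by
  split_ifs with hw
  · refine tendsto_const_nhds.congr' ?_
    filter_upwards [eventually_gt_atTop 0] with T hT
    have : (T : ℂ) ≠ 0 := by exact_mod_cast hT.ne'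
    simp [hw, this]
  · have hc : Complex.I * (w : ℂ) ≠ 0 := mul_ne_zero Complex.I_ne_zero (by exact_mod_cast hw)
    have hlim : Tendsto (fun T : ℝ => T⁻¹ * (2 / |w|)) atTop (𝓝 0) := by
      simpa using tendsto_inv_atTop_zero.mul_const (2 / |w|)
    refine squeeze_zero_norm' ?_ hlim
    filter_upwards [eventually_gt_atTop 0] with T hT
    rw [integral_exp_mul_complex hc, norm_mul, norm_inv, Complex.norm_real,
      Real.norm_of_nonneg hT.le, norm_div, norm_mul, Complex.norm_I, one_mul, Complex.norm_real,
      Real.norm_eq_abs]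
    gcongr
    refine (norm_sub_le _ _).trans (le_of_eq ?_)
    simp [Complex.norm_exp]
    norm_num

/-- An absolutely convergent trigonometric series may be averaged over `[0, T]` termwise. -/
lemma mean_tsum_exp {c : ℕ → ℂ} (hc : Summable fun ν => ‖c ν‖) (w : ℕ → ℝ) (T : ℝ) :
    (T : ℂ)⁻¹ * ∫ t in (0:ℝ)..T, ∑' ν, c ν * Complex.exp (Complex.I * w ν * t) =
      ∑' ν, c ν * ((T : ℂ)⁻¹ * ∫ t in (0:ℝ)..T, Complex.exp (Complex.I * w ν * t)) := by
  have hn (ν : ℕ) (t : ℝ) : ‖c ν * Complex.exp (Complex.I * w ν * t)‖ = ‖c ν‖ := by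
    simp [Complex.norm_exp]
  have h := intervalIntegral.hasSum_integral_of_dominated_convergence
    (μ := MeasureTheory.volume) (a := 0) (b := T)
    (F := fun ν (t : ℝ) => c ν * Complex.exp (Complex.I * w ν * t))
    (f := fun t : ℝ => ∑' ν, c ν * Complex.exp (Complex.I * w ν * t))
    (fun ν _ => ‖c ν‖)
    (fun ν => by fun_prop)
    (fun ν => .of_forall fun t _ => (hn ν t).le)
    (.of_forall fun t _ => hc)
    intervalIntegrable_const
    (.of_forall fun t _ => (Summable.of_norm (by simpa only [hn] using hc)).hasSum)
  rw [← h.tsum_eq, ← tsum_mul_left]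
  refine tsum_congr fun ν => ?_
  rw [intervalIntegral.integral_const_mul]
  ring

/-- the coefficient formula (Theorem I.3.1 of Mandelbrojt) for general
Dirichlet series: `a_κ e^{-σ μ_κ} = lim_{T→∞} (1/T) ∫_0^T D(σ+it) e^{i μ_κ t} dt`. -/
theorem coefficient_mean_value_formula
    (μ : ℕ → ℝ) (hμ : StrictMono μ)
    (a : ℕ → ℂ) (σ : ℝ)
    (hsum : Summable (fun ν => ‖a ν‖ * Real.exp (-σ * μ ν)))
    (κ : ℕ) :
    Tendsto
      (fun T : ℝ => (T : ℂ)⁻¹ *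
        ∫ t in (0:ℝ)..T,
          (∑' ν, a ν * Complex.exp (-(σ + t * Complex.I) * μ ν)) *
            Complex.exp (Complex.I * μ κ * t))
      atTop
      (𝓝 (a κ * Real.exp (-σ * μ κ))) := by
  set c : ℕ → ℂ := fun ν => a ν * Real.exp (-σ * μ ν) with hc_def
  have hc : Summable fun ν => ‖c ν‖ := by
    refine hsum.congr fun ν => ?_
    rw [hc_def, norm_mul, Complex.norm_real, Real.norm_of_nonneg (Real.exp_pos _).le]
  have hint (t : ℝ) : (∑' ν, a ν * Complex.exp (-(σ + t * Complex.I) * μ ν)) *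
      Complex.exp (Complex.I * μ κ * t) =
      ∑' ν, c ν * Complex.exp (Complex.I * (μ κ - μ ν : ℝ) * t) := by
    rw [← tsum_mul_right]
    refine tsum_congr fun ν => ?_
    simp only [hc_def]
    push_cast
    rw [mul_assoc (a ν), mul_assoc (a ν), ← Complex.exp_add, ← Complex.exp_add]
    ring_nf
  simp only [hint, mean_tsum_exp hc]
  have hlim : ∑' ν, c ν * (if μ κ - μ ν = 0 then 1 else 0) = a κ * Real.exp (-σ * μ κ) := by
    rw [tsum_eq_single κ fun ν hν => ?_]
    · simp [hc_def]
    · rw [if_neg (sub_ne_zero.2 (hμ.injective.ne hν.symm)), mul_zero]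
  rw [← hlim]
  refine tendsto_tsum_of_dominated_convergence hc
    (fun ν => (tendsto_mean_exp _).const_mul _) ?_
  filter_upwards [eventually_gt_atTop 0] with T hT ν
  rw [norm_mul]
  exact mul_le_of_le_one_right (norm_nonneg _) (norm_mean_exp_le_one _ T hT)
end

section
/- Let (μ_ν)_{ν≥1} be a strictly increasing unbounded sequence of real numbers, let (a_ν)_{ν≥1} be complex numbers, and let c>0 satisfy ∑_{ν≥1} |a_ν| e^{−c μ_ν} < ∞; set D(s)=∑_{ν≥1} a_ν e^{−s μ_ν}. Then for every x∈ℝ with x ≠ μ_ν for all ν, the principal-value Perron integral satisfies (1/(2π)) I_x(D) = (1/(2π)) lim_{T→∞} ∫_{−T}^{T} D(c+it) e^{x(c+it)}/(c+it) dt = ∑_{ν : μ_ν < x} a_ν (a finite sum). -/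
open Filter Topology Complex
open MeasureTheory FourierTransform

theorem norm_exp_real_mul_div_le {y b : ℝ} (hb : 0 < b) {z : ℂ} (hz : b ≤ ‖z‖) :
    ‖exp (y * z) / z‖ ≤ Real.exp (y * z.re) / b := by
  rw [norm_div, norm_exp, re_ofReal_mul]
  gcongr

theorem norm_integral_horizontal_le {y c T η R : ℝ} (hy : y < 0) (hT : 0 < T) (hη : |η| = T)
    (hR : c ≤ R) :
    ‖∫ r : ℝ in c..R, exp (y * (r + η * I)) / (r + η * I)‖ ≤ Real.exp (y * c) / (T * |y|) := by
  have hf_int : IntervalIntegrable (fun r : ℝ => Real.exp (y * r) / T) volume c R :=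
    Continuous.intervalIntegrable (by fun_prop) _ _
  refine (intervalIntegral.norm_integral_le_of_norm_le hR
    (Eventually.of_forall fun r _ => ?_) hf_int).trans ?_
  · have hz : T ≤ ‖(r + η * I : ℂ)‖ := by
      simpa [hη] using abs_im_le_norm (r + η * I : ℂ)
    simpa using norm_exp_real_mul_div_le (y := y) hT hz
  · rw [intervalIntegral.integral_div, intervalIntegral.integral_comp_mul_left _ hy.ne, integral_exp,
      abs_of_neg hy, smul_eq_mul, inv_mul_eq_div, div_div, ← neg_div_neg_eq]
    rw [show -(y * T) = T * -y by ring]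
    have : 0 < T * -y := mul_pos hT (neg_pos.2 hy)
    gcongr
    linarith [Real.exp_pos (y * R)]

theorem norm_perronKernel_le_of_neg {y c T : ℝ} (hc : 0 < c) (hy : y < 0) (hT : 0 < T) :
    ‖∫ t : ℝ in (-T)..T, exp (y * (c + t * I)) / (c + t * I)‖ ≤
      2 * Real.exp (y * c) / (T * |y|) := by
  have key : ∀ R, c ≤ R → ‖∫ t : ℝ in (-T)..T, exp (y * (c + t * I)) / (c + t * I)‖ ≤
      2 * Real.exp (y * c) / (T * |y|) + Real.exp (y * R) / c * (2 * T) := by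
    intro R hR
    have hrect := integral_boundary_rect_eq_zero_of_differentiableOn
      (fun s : ℂ => exp (y * s) / s) (c + (-T : ℝ) * I) (R + T * I) (by
        intro s hs
        refine DifferentiableAt.differentiableWithinAt ?_
        have hs0 : s ≠ 0 := by
          rintro rfl
          have := hs.1
          simp [Set.uIcc_of_le hR] at this
          linarith
        fun_prop (disch := assumption))
    simp only [add_re, ofReal_re, mul_re, I_re, mul_zero, ofReal_im, I_im, mul_one, sub_self,
      add_zero, add_im, mul_im, zero_add, smul_eq_mul] at hrect
    have h1 := norm_integral_horizontal_le (η := -T) hy hT (by rw [abs_neg, abs_of_pos hT]) hR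
    have h2 := norm_integral_horizontal_le (η := T) hy hT (abs_of_pos hT) hR
    have h3 : ‖∫ t : ℝ in (-T)..T, exp (y * (R + t * I)) / (R + t * I)‖ ≤
        Real.exp (y * R) / c * (2 * T) := by
      refine (intervalIntegral.norm_integral_le_of_norm_le_const (C := Real.exp (y * R) / c)
        fun t _ => ?_).trans_eq ?_
      · have hz : c ≤ ‖(R + t * I : ℂ)‖ := hR.trans <| by
          simpa using re_le_norm (R + t * I : ℂ)
        simpa using norm_exp_real_mul_div_le (y := y) hc hz
      · rw [abs_of_pos (by linarith)]; ring
    set A := ∫ r : ℝ in c..R, exp (y * (r + (-T : ℝ) * I)) / (r + (-T : ℝ) * I)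
    set B := ∫ r : ℝ in c..R, exp (y * (r + T * I)) / (r + T * I)
    set C := ∫ t : ℝ in (-T)..T, exp (y * (R + t * I)) / (R + t * I)
    set D := ∫ t : ℝ in (-T)..T, exp (y * (c + t * I)) / (c + t * I)
    have hD : I * D = A - B + I * C := by linear_combination -hrect
    calc ‖D‖ = ‖I * D‖ := by simp
      _ ≤ ‖A‖ + ‖B‖ + ‖I * C‖ := by
        rw [hD]; exact (norm_add_le _ _).trans (by gcongr; exact norm_sub_le _ _)
      _ ≤ _ := by
        rw [norm_mul, norm_I, one_mul, two_mul, add_div]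
        gcongr
  have hlim : Tendsto (fun R : ℝ => 2 * Real.exp (y * c) / (T * |y|) +
      Real.exp (y * R) / c * (2 * T)) atTop (𝓝 (2 * Real.exp (y * c) / (T * |y|))) := by
    have h0 : Tendsto (fun R : ℝ => Real.exp (y * R)) atTop (𝓝 0) :=
      Real.tendsto_exp_atBot.comp (tendsto_id.const_mul_atTop_of_neg hy)
    simpa using ((h0.div_const c).mul_const (2 * T)).const_add (2 * Real.exp (y * c) / (T * |y|))
  exact ge_of_tendsto hlim ((eventually_ge_atTop c).mono key)

theorem integrable_two_mul_div_sq_add_sq {c : ℝ} (hc : 0 < c) :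
    Integrable fun t : ℝ => (2 * c / (c ^ 2 + t ^ 2)) := by
  have := (integrable_inv_one_add_sq.comp_div hc.ne').const_mul (2 / c)
  refine this.congr (Eventually.of_forall fun t => ?_)
  have : c ^ 2 + t ^ 2 ≠ 0 := by positivity
  have : 1 + (t / c) ^ 2 ≠ 0 := by positivity
  simp only
  field_simp

theorem integral_two_mul_div_sq_add_sq {c : ℝ} (hc : 0 < c) :
    ∫ t : ℝ, (2 * c / (c ^ 2 + t ^ 2)) = 2 * Real.pi := by
  have h := Measure.integral_comp_div (fun t : ℝ => (1 + t ^ 2)⁻¹) c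
  rw [integral_univ_inv_one_add_sq, abs_of_pos hc, smul_eq_mul] at h
  calc _ = ∫ t : ℝ, 2 / c * (1 + (t / c) ^ 2)⁻¹ := by
        congr 1 with t
        have : c ^ 2 + t ^ 2 ≠ 0 := by positivity
        have : 1 + (t / c) ^ 2 ≠ 0 := by positivity
        field_simp
    _ = _ := by rw [integral_const_mul, h]; field_simp

theorem fourier_exp_neg_mul_abs {c : ℝ} (hc : 0 < c) :
    Integrable (fun v : ℝ => exp (-c * |v| : ℝ)) ∧
    𝓕 (fun v : ℝ => exp (-c * |v| : ℝ)) =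
      fun w : ℝ => ((2 * c / (c ^ 2 + (2 * Real.pi * w) ^ 2) : ℝ) : ℂ) := by
  have hIic (w : ℝ) : Set.EqOn (fun v : ℝ => exp ((-2 * Real.pi * v * w : ℝ) * I) •
      exp (-c * |v| : ℝ)) (fun v => exp ((c - 2 * Real.pi * w * I) * v)) (Set.Iic 0) := by
    intro v hv
    simp only [smul_eq_mul, ← exp_add, abs_of_nonpos (Set.mem_Iic.1 hv)]
    push_cast
    ring_nf
  have hIoi (w : ℝ) : Set.EqOn (fun v : ℝ => exp ((-2 * Real.pi * v * w : ℝ) * I) •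
      exp (-c * |v| : ℝ)) (fun v => exp ((-c - 2 * Real.pi * w * I) * v)) (Set.Ioi 0) := by
    intro v hv
    simp only [smul_eq_mul, ← exp_add, abs_of_pos (Set.mem_Ioi.1 hv)]
    push_cast
    ring_nf
  have hre1 (w : ℝ) : 0 < (c - 2 * Real.pi * w * I : ℂ).re := by simpa
  have hre2 (w : ℝ) : (-c - 2 * Real.pi * w * I : ℂ).re < 0 := by simpa
  have hi1 (w : ℝ) := (integrableOn_congr_fun (hIic w) measurableSet_Iic).2
    (integrableOn_exp_mul_complex_Iic (hre1 w) 0)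
  have hi2 (w : ℝ) := (integrableOn_congr_fun (hIoi w) measurableSet_Ioi).2
    (integrableOn_exp_mul_complex_Ioi (hre2 w) 0)
  constructor
  · have := integrableOn_univ.1 (Set.Iic_union_Ioi (a := (0 : ℝ)) ▸ (hi1 0).union (hi2 0))
    simpa using this
  · ext w
    rw [Real.fourier_real_eq_integral_exp_smul,
      ← intervalIntegral.integral_Iic_add_Ioi (hi1 w) (hi2 w),
      setIntegral_congr_fun measurableSet_Iic (hIic w),
      setIntegral_congr_fun measurableSet_Ioi (hIoi w),
      integral_exp_mul_complex_Iic (hre1 w), integral_exp_mul_complex_Ioi (hre2 w)]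
    have h1 : (c - 2 * Real.pi * w * I : ℂ) ≠ 0 := fun h => by simpa [h] using hre1 w
    have h2 : (-c - 2 * Real.pi * w * I : ℂ) ≠ 0 := fun h => by simpa [h] using hre2 w
    have h3 : (c ^ 2 + (2 * Real.pi * w) ^ 2 : ℂ) ≠ 0 := by
      norm_cast
      positivity
    push_cast
    simp only [mul_zero, exp_zero]
    rw [div_add_div _ _ h1 h2, div_eq_div_iff (mul_ne_zero h1 h2) h3]
    linear_combination (-2 * c * (2 * Real.pi * w : ℂ) ^ 2) * I_sq

theorem integral_exp_mul_I_mul_two_mul_div_sq_add_sq {c : ℝ} (hc : 0 < c) (y : ℝ) :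
    ∫ t : ℝ, exp (y * t * I) * (2 * c / (c ^ 2 + t ^ 2) : ℝ) =
      2 * Real.pi * Real.exp (-c * |y|) := by
  obtain ⟨hf_int, hF⟩ := fourier_exp_neg_mul_abs hc
  have hF_int : Integrable (𝓕 (fun v : ℝ => exp (-c * |v| : ℝ))) := by
    rw [hF]
    exact ((integrable_two_mul_div_sq_add_sq hc).comp_mul_left' (R := 2 * Real.pi)
      (by positivity)).ofReal
  have hinv := congrFun (Continuous.fourierInv_fourier_eq (by fun_prop) hf_int hF_int) y
  rw [hF, Real.fourierInv_eq'] at hinv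
  have hscale := Measure.integral_comp_mul_left
    (fun t : ℝ => exp (y * t * I) * (2 * c / (c ^ 2 + t ^ 2) : ℝ)) (2 * Real.pi)
  have heq : (fun v : ℝ => exp ((2 * Real.pi * inner ℝ v y : ℝ) * I) •
      ((2 * c / (c ^ 2 + (2 * Real.pi * v) ^ 2) : ℝ) : ℂ)) =
      fun v : ℝ => exp (y * (2 * Real.pi * v : ℝ) * I) *
        (2 * c / (c ^ 2 + (2 * Real.pi * v) ^ 2) : ℝ) := by
    ext v
    simp only [smul_eq_mul, RCLike.inner_apply, conj_trivial]
    push_cast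
    ring_nf
  rw [heq, hscale, abs_of_pos (by positivity)] at hinv
  have hpi : (2 * Real.pi : ℂ) * ((2 * Real.pi)⁻¹ : ℝ) = 1 := by
    push_cast
    exact mul_inv_cancel₀ (by norm_num)
  rw [ofReal_exp, ← hinv, real_smul, ← mul_assoc, hpi, one_mul]

theorem norm_exp_mul_I_mul_two_mul_div_sq_add_sq {c : ℝ} (hc : 0 < c) (y t : ℝ) :
    ‖exp (y * t * I) * (2 * c / (c ^ 2 + t ^ 2) : ℝ)‖ = 2 * c / (c ^ 2 + t ^ 2) := by
  rw [norm_mul, ← ofReal_mul, norm_exp_ofReal_mul_I, one_mul, norm_real, Real.norm_of_nonneg]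
  positivity

theorem integrable_exp_mul_I_mul_two_mul_div_sq_add_sq {c : ℝ} (hc : 0 < c) (y : ℝ) :
    Integrable fun t : ℝ => exp (y * t * I) * (2 * c / (c ^ 2 + t ^ 2) : ℝ) := by
  refine (integrable_two_mul_div_sq_add_sq hc).mono' ?_
    (Eventually.of_forall fun t => (norm_exp_mul_I_mul_two_mul_div_sq_add_sq hc y t).le)
  have : Measurable fun t : ℝ => exp (y * t * I) * (2 * c / (c ^ 2 + t ^ 2) : ℝ) := by fun_prop
  exact this.aestronglyMeasurable

theorem norm_integral_exp_mul_I_mul_two_mul_div_sq_add_sq_le {c T : ℝ} (hc : 0 < c) (hT : 0 < T)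
    (y : ℝ) :
    ‖∫ t : ℝ in (-T)..T, exp (y * t * I) * (2 * c / (c ^ 2 + t ^ 2) : ℝ)‖ ≤ 2 * Real.pi := by
  rw [intervalIntegral.integral_of_le (by linarith), ← integral_two_mul_div_sq_add_sq hc]
  refine (norm_integral_le_integral_norm _).trans ?_
  simp_rw [norm_exp_mul_I_mul_two_mul_div_sq_add_sq hc]
  exact setIntegral_le_integral (integrable_two_mul_div_sq_add_sq hc)
    (Eventually.of_forall fun t => by positivity)

theorem add_mul_I_ne_zero {c : ℝ} (hc : 0 < c) (t : ℝ) : (c + t * I : ℂ) ≠ 0 := fun h => by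
  have := congrArg re h
  simp at this
  exact hc.ne' this

theorem continuous_perronKernel {c : ℝ} (hc : 0 < c) (y : ℝ) :
    Continuous fun t : ℝ => exp (y * (c + t * I)) / (c + t * I) :=
  Continuous.div (by fun_prop) (by fun_prop) (add_mul_I_ne_zero hc)

theorem perronKernel_eq_sub_reflect {c : ℝ} (hc : 0 < c) (y T : ℝ) :
    ∫ t : ℝ in (-T)..T, exp (y * (c + t * I)) / (c + t * I) =
      Real.exp (y * c) * (∫ t : ℝ in (-T)..T, exp (y * t * I) * (2 * c / (c ^ 2 + t ^ 2) : ℝ)) -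
      Real.exp (2 * y * c) *
        ∫ t : ℝ in (-T)..T, exp ((-y : ℝ) * (c + t * I)) / (c + t * I) := by
  have hneg := intervalIntegral.integral_comp_neg (a := -T) (b := T)
    (fun t : ℝ => exp ((-y : ℝ) * (c + t * I)) / (c + t * I))
  rw [neg_neg] at hneg
  rw [← hneg, ← intervalIntegral.integral_const_mul, ← intervalIntegral.integral_const_mul,
    ← intervalIntegral.integral_sub]
  · congr 1 with t
    have h1 := add_mul_I_ne_zero hc t
    have h2 := add_mul_I_ne_zero hc (-t)
    have h3 : (c ^ 2 + t ^ 2 : ℂ) ≠ 0 := by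
      norm_cast
      positivity
    have e1 : exp (y * (c + t * I)) = Real.exp (y * c) * exp (y * t * I) := by
      rw [ofReal_exp, ← exp_add]
      push_cast
      ring_nf
    have e2 : Real.exp (2 * y * c) * exp ((-y : ℝ) * (c + (-t : ℝ) * I)) =
        Real.exp (y * c) * exp (y * t * I) := by
      rw [ofReal_exp, ofReal_exp, ← exp_add, ← exp_add]
      push_cast
      ring_nf
    rw [mul_div_assoc', e2, e1]
    have h2' : (c - t * I : ℂ) ≠ 0 := by
      simpa [sub_eq_add_neg] using h2
    push_cast
    rw [neg_mul, ← sub_eq_add_neg]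
    field_simp
    linear_combination (2 * (t : ℂ) ^ 2 * c) * I_sq
  · exact (((integrable_exp_mul_I_mul_two_mul_div_sq_add_sq hc y).intervalIntegrable).const_mul _)
  · exact (((continuous_perronKernel hc (-y)).comp continuous_neg).const_mul _).intervalIntegrable _ _

theorem norm_perronKernel_le {y c T : ℝ} (hc : 0 < c) (hy : y ≠ 0) (hT : 0 < T) :
    ‖∫ t : ℝ in (-T)..T, exp (y * (c + t * I)) / (c + t * I)‖ ≤
      Real.exp (y * c) * (2 * Real.pi + 2 / (T * |y|)) := by
  rcases hy.lt_or_gt with hy | hy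
  · refine (norm_perronKernel_le_of_neg hc hy hT).trans ?_
    have := mul_pos (Real.exp_pos (y * c)) Real.two_pi_pos
    rw [mul_add, mul_comm 2, mul_div_assoc]
    linarith
  · rw [perronKernel_eq_sub_reflect hc]
    refine (norm_sub_le _ _).trans ?_
    rw [norm_mul, norm_mul, norm_real, norm_real, Real.norm_of_nonneg (Real.exp_nonneg _),
      Real.norm_of_nonneg (Real.exp_nonneg _), mul_add]
    have h := norm_perronKernel_le_of_neg hc (neg_neg_of_pos hy) hT
    rw [abs_neg] at h
    have he : Real.exp (2 * y * c) * Real.exp (-y * c) = Real.exp (y * c) := by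
      rw [← Real.exp_add]
      ring_nf
    refine add_le_add ?_ ?_
    · gcongr
      exact norm_integral_exp_mul_I_mul_two_mul_div_sq_add_sq_le hc hT y
    · refine (mul_le_mul_of_nonneg_left h (Real.exp_nonneg _)).trans_eq ?_
      rw [← he]
      ring

theorem tendsto_perronKernel_of_neg {y c : ℝ} (hc : 0 < c) (hy : y < 0) :
    Tendsto (fun T : ℝ => ∫ t : ℝ in (-T)..T, exp (y * (c + t * I)) / (c + t * I))
      atTop (𝓝 0) := by
  refine squeeze_zero_norm' (a := fun T => 2 * Real.exp (y * c) / (T * |y|))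
    ((eventually_gt_atTop 0).mono fun T hT => norm_perronKernel_le_of_neg hc hy hT) ?_
  exact tendsto_const_nhds.div_atTop (tendsto_id.atTop_mul_const (abs_pos.2 hy.ne))

theorem tendsto_perronKernel {y c : ℝ} (hc : 0 < c) (hy : y ≠ 0) :
    Tendsto (fun T : ℝ => ∫ t : ℝ in (-T)..T, exp (y * (c + t * I)) / (c + t * I))
      atTop (𝓝 (if 0 < y then 2 * Real.pi else 0)) := by
  rcases hy.lt_or_gt with hy | hy
  · rw [if_neg hy.not_gt]
    exact tendsto_perronKernel_of_neg hc hy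
  · simp_rw [if_pos hy, perronKernel_eq_sub_reflect hc y]
    have h1 := intervalIntegral_tendsto_integral
      (integrable_exp_mul_I_mul_two_mul_div_sq_add_sq hc y) tendsto_neg_atTop_atBot
      (tendsto_id (α := ℝ))
    simp only [integral_exp_mul_I_mul_two_mul_div_sq_add_sq hc, abs_of_pos hy, id_eq] at h1
    have h2 := (tendsto_perronKernel_of_neg hc (neg_neg_of_pos hy)).const_mul
      (Real.exp (2 * y * c) : ℂ)
    convert (h1.const_mul (Real.exp (y * c) : ℂ)).sub h2 using 2
    have he : (Real.exp (y * c) : ℂ) * Real.exp (-c * y) = 1 := by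
      rw [← ofReal_mul, ← Real.exp_add]
      ring_nf
      simp
    linear_combination -(2 * Real.pi : ℂ) * he

theorem hasSum_integral_perronKernel (μ : ℕ → ℝ) (a : ℕ → ℂ) {c : ℝ} (hc : 0 < c)
    (hsum : Summable (fun ν => ‖a ν‖ * Real.exp (-c * μ ν))) (x T : ℝ) :
    HasSum (fun ν => ∫ t : ℝ in (-T)..T,
        a ν * (exp ((x - μ ν : ℝ) * (c + t * I)) / (c + t * I)))
      (∫ t : ℝ in (-T)..T, (∑' ν, a ν * exp (-(c + t * I) * μ ν)) *
        exp ((x : ℂ) * (c + t * I)) / (c + t * I)) := by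
  have hsum' : Summable fun ν => ‖a ν‖ * Real.exp (-c * μ ν) * (Real.exp (x * c) / c) :=
    hsum.mul_right _
  refine intervalIntegral.hasSum_integral_of_dominated_convergence
    (fun ν _ => ‖a ν‖ * Real.exp (-c * μ ν) * (Real.exp (x * c) / c)) (fun ν => ?_)
    (fun ν => Eventually.of_forall fun t _ => ?_) (Eventually.of_forall fun t _ => hsum')
    intervalIntegrable_const (Eventually.of_forall fun t _ => ?_)
  · exact ((continuous_perronKernel hc _).const_mul _).aestronglyMeasurable
  · have hz : c ≤ ‖(c + t * I : ℂ)‖ := by simpa using re_le_norm (c + t * I : ℂ)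
    have h := norm_exp_real_mul_div_le (y := x - μ ν) hc hz
    have he : Real.exp ((x - μ ν) * c) = Real.exp (-c * μ ν) * Real.exp (x * c) := by
      rw [← Real.exp_add]
      ring_nf
    have hre : (c + t * I : ℂ).re = c := by simp
    rw [hre, he] at h
    rw [norm_mul, mul_assoc, mul_div_assoc']
    gcongr
  · have hs : Summable fun ν => a ν * exp (-(c + t * I) * μ ν) := by
      refine Summable.of_norm (hsum.congr fun ν => ?_)
      rw [norm_mul, norm_exp]
      simp
    refine ((hs.hasSum.mul_right (exp ((x : ℂ) * (c + t * I)))).div_const (c + t * I : ℂ)).congr_fun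
      fun ν => ?_
    rw [← mul_div_assoc, mul_assoc, ← exp_add]
    push_cast
    ring_nf

theorem exists_pos_le_abs_sub {μ : ℕ → ℝ} (hμ_top : Tendsto μ atTop atTop) {x : ℝ}
    (hx : ∀ ν, x ≠ μ ν) : ∃ δ > 0, ∀ ν, δ ≤ |x - μ ν| := by
  obtain ⟨M, hM⟩ := ((tendsto_inv_atTop_zero.comp
    (tendsto_abs_atBot_atTop.comp (tendsto_const_nhds (x := x).add_atBot
      (tendsto_neg_atTop_atBot.comp hμ_top))))).bddAbove_range
  have hle (ν : ℕ) : |x - μ ν|⁻¹ ≤ M := hM ⟨ν, by simp [sub_eq_add_neg]⟩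
  have hpos (ν : ℕ) : 0 < |x - μ ν| := abs_pos.2 (sub_ne_zero.2 (hx ν))
  have hM0 : 0 < M := (inv_pos.2 (hpos 0)).trans_le (hle 0)
  exact ⟨M⁻¹, inv_pos.2 hM0, fun ν => inv_le_of_inv_le₀ (hpos ν) (hle ν)⟩

/-- Perron's formula. For an absolutely convergent general Dirichlet series
`D(s) = ∑ a_ν e^{-s μ_ν}` at `Re s = c > 0`, and `x` distinct from all exponents,
`(1/(2π)) lim_{T→∞} ∫_{-T}^{T} D(c+it) e^{x(c+it)}/(c+it) dt = ∑_{μ_ν < x} a_ν`. -/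
theorem perron_formula
    (μ : ℕ → ℝ) (hμ : StrictMono μ) (hμ_top : Tendsto μ atTop atTop)
    (a : ℕ → ℂ) (c : ℝ) (hc : 0 < c)
    (hsum : Summable (fun ν => ‖a ν‖ * Real.exp (-c * μ ν)))
    (x : ℝ) (hx : ∀ ν, x ≠ μ ν) :
    Tendsto
      (fun T : ℝ => (1 / (2 * Real.pi) : ℂ) *
        ∫ t in (-T)..T,
          (∑' ν, a ν * Complex.exp (-(c + t * Complex.I) * μ ν)) *
            Complex.exp ((x : ℂ) * (c + t * Complex.I)) / (c + t * Complex.I))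
      atTop
      (𝓝 (∑' ν, if μ ν < x then a ν else 0)) := by
  obtain ⟨δ, hδ, hδμ⟩ := exists_pos_le_abs_sub hμ_top hx
  have hne (ν : ℕ) : x - μ ν ≠ 0 := sub_ne_zero.2 (hx ν)
  have hlim : Tendsto (fun T : ℝ => ∑' ν, ∫ t : ℝ in (-T)..T,
      a ν * (exp ((x - μ ν : ℝ) * (c + t * I)) / (c + t * I))) atTop
      (𝓝 (∑' ν, a ν * if 0 < x - μ ν then (2 * Real.pi : ℂ) else 0)) := by
    refine tendsto_tsum_of_dominated_convergence
      (bound := fun ν => ‖a ν‖ * Real.exp (-c * μ ν) *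
        (Real.exp (x * c) * (2 * Real.pi + 2 / δ)))
      (hsum.mul_right _) (fun ν => ?_) ((eventually_ge_atTop 1).mono fun T hT ν => ?_)
    · simp_rw [intervalIntegral.integral_const_mul]
      exact (tendsto_perronKernel hc (hne ν)).const_mul _
    · rw [intervalIntegral.integral_const_mul, norm_mul, mul_assoc]
      refine mul_le_mul_of_nonneg_left ?_ (norm_nonneg _)
      refine (norm_perronKernel_le hc (hne ν) (by linarith)).trans ?_
      rw [← mul_assoc, ← Real.exp_add]
      have he : (x - μ ν) * c = -c * μ ν + x * c := by ring
      rw [he]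
      gcongr
      exact (hδμ ν).trans (le_mul_of_one_le_left (abs_nonneg _) hT)
  simp_rw [(hasSum_integral_perronKernel μ a hc hsum x _).tsum_eq] at hlim
  convert hlim.const_mul (1 / (2 * Real.pi) : ℂ) using 2
  rw [← tsum_mul_left]
  congr 1 with ν
  have hpi : (Real.pi : ℂ) ≠ 0 := ofReal_ne_zero.2 Real.pi_ne_zero
  by_cases h : μ ν < x
  · simp only [h, sub_pos, if_true]
    field_simp
  · simp [h, sub_pos]
end

section
/- Let c>0. For each n∈ℕ let (λ_{n,j})_{j≥1} be a strictly increasing unbounded sequence of positive real numbers and (a_{n,j})_{j≥1} complex numbers with ∑_{j≥1} |a_{n,j}| λ_{n,j}^{−c} < ∞, and set D_n(s)=∑_{j≥1} a_{n,j} λ_{n,j}^{−s}. Let (λ_i)_{i≥1} be a strictly increasing unbounded sequence of positive reals and (a_i)_{i≥1} complex numbers with ∑_{i≥1} |a_i| λ_i^{−c} < ∞ and a_i ≠ 0 for all i, and set D(s)=∑_{i≥1} a_i λ_i^{−s}. Suppose the functions t ↦ D_n(c+it) converge multiplicatively to t ↦ D(c+it). Then for every index i and every ε>0, for all sufficiently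 large n there exists j with |λ_{n,j} − λ_i| ≤ ε; in particular each λ_i is an accumulation point of the family {λ_{n,j}}. -/
open Filter Topology Complex MeasureTheory

/-- A sequence of functions `h_n : ℝ → ℂ` converges multiplicatively to `h : ℝ → ℂ` if
there is a strictly positive `g : ℝ → ℝ`, integrable against `dt/|t|`, such that
`sup_t |h_n(t) - h(t)|/g(t) → 0`. -/
def MultiplicativelyConverges (h : ℕ → ℝ → ℂ) (h₀ : ℝ → ℂ) : Prop :=
  ∃ g : ℝ → ℝ, (∀ t, 0 < g t) ∧ Integrable (fun t => g t / |t|) ∧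
    TendstoUniformly (fun n t => (h n t - h₀ t) / (g t : ℂ)) 0 atTop

open scoped FourierTransform SchwartzMap

/-- Integrating a Schwartz function against a Dirichlet series on a vertical line evaluates its
Fourier transform at the logarithms of the frequencies. -/
theorem integral_schwartz_mul_dirichletSeries (F : 𝓢(ℝ, ℂ)) (c : ℝ) (l : ℕ → ℝ)
    (hl : ∀ j, 0 < l j) (a : ℕ → ℂ) (hs : Summable fun j => ‖a j‖ * l j ^ (-c)) :
    Integrable (fun t : ℝ => F t * ∑' j, a j * (l j : ℂ) ^ (-(c + t * Complex.I))) ∧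
    ∫ t : ℝ, F t * ∑' j, a j * (l j : ℂ) ^ (-(c + t * Complex.I)) =
      ∑' j, a j * (l j : ℂ) ^ (-c : ℂ) * 𝓕 (F : ℝ → ℂ) (Real.log (l j) / (2 * Real.pi)) := by
  have hnorm (j : ℕ) (t : ℝ) :
      ‖a j * (l j : ℂ) ^ (-(c + t * Complex.I))‖ = ‖a j‖ * l j ^ (-c) := by
    rw [norm_mul, Complex.norm_cpow_eq_rpow_re_of_pos (hl j)]
    simp
  have hcont (j : ℕ) : Continuous fun t : ℝ => a j * (l j : ℂ) ^ (-(c + t * Complex.I)) := by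
    have h0 : (l j : ℂ) ≠ 0 := by exact_mod_cast (hl j).ne'
    refine continuous_const.mul (Continuous.const_cpow (by fun_prop) (Or.inl h0))
  have hint (j : ℕ) : Integrable fun t : ℝ => F t * (a j * (l j : ℂ) ^ (-(c + t * Complex.I))) :=
    F.integrable.mul_bdd (c := ‖a j‖ * l j ^ (-c)) (hcont j).aestronglyMeasurable
      (Eventually.of_forall fun t => (hnorm j t).le)
  constructor
  · refine F.integrable.mul_bdd (c := ∑' j, ‖a j‖ * l j ^ (-c))
      (Continuous.aestronglyMeasurable ?_) (Eventually.of_forall fun t => ?_)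
    · exact continuous_tsum hcont hs fun j t => (hnorm j t).le
    · exact tsum_of_norm_bounded hs.hasSum fun j => (hnorm j t).le
  · simp_rw [← tsum_mul_left]
    rw [← integral_tsum_of_summable_integral_norm hint]
    · refine tsum_congr fun j => ?_
      have h0 : (l j : ℂ) ≠ 0 := by exact_mod_cast (hl j).ne'
      rw [Real.fourier_real_eq_integral_exp_smul, ← integral_const_mul]
      refine integral_congr_ae (Eventually.of_forall fun t => ?_)
      have hpi : (Real.pi : ℂ) ≠ 0 := by exact_mod_cast Real.pi_ne_zero
      simp only [smul_eq_mul]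
      rw [neg_add, Complex.cpow_add _ _ h0, Complex.cpow_def_of_ne_zero h0 (-(t * Complex.I)),
        ← Complex.ofReal_log (hl j).le]
      have : (Real.log (l j) : ℂ) * -(t * Complex.I) =
          ((-2 * Real.pi * t * (Real.log (l j) / (2 * Real.pi)) : ℝ) : ℂ) * Complex.I := by
        push_cast
        field_simp
      rw [this]
      ring
    · simp_rw [norm_mul (F _), hnorm, integral_mul_const]
      exact hs.mul_left _

/-- A Schwartz function whose Fourier transform is a bump at `p`. -/
theorem exists_schwartz_fourier_bump (p r : ℝ) (hr : 0 < r) :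
    ∃ F : 𝓢(ℝ, ℂ), 𝓕 (F : ℝ → ℂ) p = 1 ∧ ∀ x, r ≤ |x - p| → 𝓕 (F : ℝ → ℂ) x = 0 := by
  let f : ContDiffBump p := ⟨r / 2, r, by positivity, by linarith⟩
  have hc : HasCompactSupport fun x => (f x : ℂ) := f.hasCompactSupport.comp_left Complex.ofReal_zero
  let φ : 𝓢(ℝ, ℂ) := hc.toSchwartzMap (Complex.ofRealCLM.contDiff.comp f.contDiff)
  have hφ : 𝓕 ((𝓕⁻ φ : 𝓢(ℝ, ℂ)) : ℝ → ℂ) = fun x => (f x : ℂ) := by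
    rw [← SchwartzMap.fourier_coe, FourierTransform.fourier_fourierInv_eq]
    rfl
  refine ⟨𝓕⁻ φ, ?_, fun x hx => ?_⟩
  · rw [hφ]
    simp [f.one_of_mem_closedBall (Metric.mem_closedBall_self f.rIn_pos.le)]
  · rw [hφ]
    simp [f.zero_of_le_dist (x := x) (by simpa [Real.dist_eq] using hx)]

/-- Terms of a strictly increasing real sequence are isolated from each other. -/
theorem StrictMono.exists_pos_le_abs_sub {l : ℕ → ℝ} (hl : StrictMono l) (i : ℕ) :
    ∃ δ > 0, ∀ k, k ≠ i → δ ≤ |l k - l i| := by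
  have hup (k : ℕ) (h : i < k) : l (i + 1) - l i ≤ |l k - l i| :=
    (sub_le_sub_right (hl.monotone h) _).trans (le_abs_self _)
  have hpos : 0 < l (i + 1) - l i := sub_pos.2 (hl i.lt_succ_self)
  cases i with
  | zero => exact ⟨_, hpos, fun k hk => hup k (Nat.pos_of_ne_zero hk)⟩
  | succ m =>
    refine ⟨min (l (m + 1 + 1) - l (m + 1)) (l (m + 1) - l m),
      lt_min hpos (sub_pos.2 (hl m.lt_succ_self)), fun k hk => ?_⟩
    rcases hk.lt_or_gt with h | h
    · refine (min_le_right _ _).trans ?_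
      rw [abs_sub_comm]
      exact (sub_le_sub_left (hl.monotone (Nat.lt_succ_iff.1 h)) _).trans (le_abs_self _)
    · exact (min_le_left _ _).trans (hup k h)

/-- Multiplicative convergence gives convergence of integrals against Schwartz functions. -/
theorem MultiplicativelyConverges.tendsto_integral {h : ℕ → ℝ → ℂ} {h₀ : ℝ → ℂ}
    (hh : MultiplicativelyConverges h h₀) (F : 𝓢(ℝ, ℂ))
    (hi : ∀ n, Integrable fun t => F t * h n t) (hi₀ : Integrable fun t => F t * h₀ t) :
    Tendsto (fun n => ∫ t, F t * h n t) atTop (𝓝 (∫ t, F t * h₀ t)) := by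
  obtain ⟨g, hg, hgi, hu⟩ := hh
  obtain ⟨C, hC, hF⟩ := F.decay 1 0
  set M := ∫ t, g t / |t|
  have hM : 0 ≤ M := integral_nonneg fun t => div_nonneg (hg t).le (abs_nonneg t)
  rw [Metric.tendsto_nhds]
  intro ε hε
  have hδ : 0 < ε / (C * M + 1) := by positivity
  filter_upwards [Metric.tendstoUniformly_iff.1 hu _ hδ] with n hn
  rw [dist_eq_norm, ← integral_sub (hi n) hi₀]
  have hle : ‖∫ t, (F t * h n t - F t * h₀ t)‖ ≤ ∫ t, (C * (ε / (C * M + 1))) * (g t / |t|) := by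
    refine norm_integral_le_of_norm_le (hgi.const_mul _) ?_
    filter_upwards [Measure.ae_ne volume (0 : ℝ)] with t ht
    have ht' : 0 < |t| := abs_pos.2 ht
    have h1 : |t| * ‖F t‖ ≤ C := by simpa using hF t
    have h2 : ‖h n t - h₀ t‖ ≤ ε / (C * M + 1) * g t := by
      have := (hn t).le
      rwa [Pi.zero_apply, dist_zero_left, norm_div, Complex.norm_real, Real.norm_of_nonneg (hg t).le,
        div_le_iff₀ (hg t)] at this
    rw [← mul_sub, norm_mul]
    calc ‖F t‖ * ‖h n t - h₀ t‖ ≤ C / |t| * (ε / (C * M + 1) * g t) := by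
          gcongr
          rwa [le_div_iff₀ ht', mul_comm]
      _ = _ := by ring
  rw [integral_const_mul] at hle
  refine hle.trans_lt ?_
  calc C * (ε / (C * M + 1)) * M = ε * (C * M / (C * M + 1)) := by ring
    _ < ε * 1 := by
        gcongr
        rw [div_lt_one (by positivity)]
        linarith
    _ = ε := mul_one ε

/-- if `D_n(c+it)` converges multiplicatively to `D(c+it)` and all the
coefficients `a_i` of `D` are nonzero, then every exponent `λ_i` of `D` is approximated,
for all large `n`, within `ε` by some exponent `λ_{n,j}`; in particular each `λ_i` is an
accumulation point of the family `{λ_{n,j}}`. -/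
theorem exponents_are_accumulation_points
    (c : ℝ) (hc : 0 < c)
    (lam : ℕ → ℕ → ℝ) (hlam_mono : ∀ n, StrictMono (lam n))
    (hlam_top : ∀ n, Tendsto (lam n) atTop atTop)
    (hlam_pos : ∀ n j, 0 < lam n j)
    (a : ℕ → ℕ → ℂ)
    (hsa : ∀ n, Summable (fun j => ‖a n j‖ * lam n j ^ (-c)))
    (l : ℕ → ℝ) (hl_mono : StrictMono l) (hl_top : Tendsto l atTop atTop)
    (hl_pos : ∀ i, 0 < l i)
    (b : ℕ → ℂ) (hsb : Summable (fun i => ‖b i‖ * l i ^ (-c)))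
    (hb : ∀ i, b i ≠ 0)
    (hconv : MultiplicativelyConverges
      (fun n t => ∑' j, a n j * (lam n j : ℂ) ^ (-(c + t * Complex.I)))
      (fun t => ∑' i, b i * (l i : ℂ) ^ (-(c + t * Complex.I)))) :
    ∀ i, ∀ ε > 0, ∀ᶠ n in atTop, ∃ j, |lam n j - l i| ≤ ε := by
  intro i ε hε
  obtain ⟨δ, hδ, hsep⟩ := hl_mono.exists_pos_le_abs_sub i
  have hlog (x : ℝ) (hx : 0 < x) : Real.exp (2 * Real.pi * (Real.log x / (2 * Real.pi))) = x := by
    rw [mul_div_cancel₀ _ (by positivity), Real.exp_log hx]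
  set p := Real.log (l i) / (2 * Real.pi) with hp
  have hcont : ContinuousAt (fun y => Real.exp (2 * Real.pi * y)) p := by fun_prop
  obtain ⟨r, hr, hball⟩ := Metric.continuousAt_iff.1 hcont (min δ ε) (lt_min hδ hε)
  have hfar (x : ℝ) (hx : 0 < x) (h : min δ ε ≤ |x - l i|) :
      r ≤ |Real.log x / (2 * Real.pi) - p| := by
    by_contra! hlt
    have := hball hlt
    rw [hlog x hx, hp, hlog _ (hl_pos i), Real.dist_eq] at this
    exact this.not_ge h
  obtain ⟨F, hF1, hF0⟩ := exists_schwartz_fourier_bump p r hr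
  have hD := integral_schwartz_mul_dirichletSeries F c l hl_pos b hsb
  have hDn n := integral_schwartz_mul_dirichletSeries F c (lam n) (hlam_pos n) (a n) (hsa n)
  have hne : ∫ t : ℝ, F t * ∑' i, b i * (l i : ℂ) ^ (-(c + t * Complex.I)) ≠ 0 := by
    rw [hD.2, tsum_eq_single i fun k hk => ?_]
    · rw [← hp, hF1, mul_one]
      refine mul_ne_zero (hb i) ?_
      rw [Ne, Complex.cpow_eq_zero_iff]
      exact fun h => (hl_pos i).ne' (by exact_mod_cast h.1)
    · rw [hF0 _ (hfar _ (hl_pos k) ((min_le_left _ _).trans (hsep k hk))), mul_zero]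
  filter_upwards [(hconv.tendsto_integral F (fun n => (hDn n).1) hD.1).eventually_ne hne] with n hn
  by_contra! hnot
  refine hn ?_
  rw [(hDn n).2]
  refine (tsum_congr fun j => ?_).trans tsum_zero
  rw [hF0 _ (hfar _ (hlam_pos n j) ((min_le_right _ _).trans (hnot j).le)), mul_zero]
end
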